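/- arXiv:2312.13701 — 3 statements merged into one kernel-verified Lean document; each statement's English description precedes it below -/
import Mathlib

section
/- Let m ≥ 5 be odd, let u be a positive integer with gcd(u, m) = 1, and suppose either (m² − 1)/8 is even and ρ = 0, or (m² − 1)/8 is odd and ρ = 1. Set n = 2^{m−2} − 2^{(m−3)/2} and d = 2^{m−3} − 2^{(m−3)/2}. Then for every integer r with 2 ≤ r and 2r ≤ n − 2 such that A_{2r}(C_{D_ρ}^⊥) > 0, the codewords of weight 2r in the dual code C_{D_ρ}^⊥ hold a 2-(n, 2r, λ_r^⊥) design, where λ_r^⊥·n·(n − 1) = 2r·(2r − 1)·A_{2r}(C_{D_ρ}^⊥) and 2^{m−1}·A_{2r}(C_{D_ρ}^⊥) = binom(n, 2r) + (2^{m−1} − 1)·Σ_{(i,j): 0 ≤ i ≤ d, 0 ≤ j ≤ 2^{(m−5)/2}, i + j = r} (−1)^i·binom(d, i)·binom(n − 2d, 2j). -/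
/-- Hamming weight of a binary vector: the number of nonzero coordinates. -/
noncomputable def wt {ι : Type*} (c : ι → ZMod 2) : ℕ := Nat.card {i : ι // c i ≠ 0}

/-- Number of codewords of Hamming weight `w` in a set of binary vectors. -/
noncomputable def weightCount {ι : Type*} (C : Set (ι → ZMod 2)) (w : ℕ) : ℕ :=
  Nat.card {c : ι → ZMod 2 // c ∈ C ∧ wt c = w}

/-- The dual code: all vectors orthogonal (standard inner product) to every codeword. -/
def dualCode {ι : Type*} (C : Set (ι → ZMod 2)) : Set (ι → ZMod 2) :=
  {x | ∀ c ∈ C, ∑ᶠ i, x i * c i = 0}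

/-- A code is projective if the minimum distance of its dual is at least 3. -/
def IsProjective {ι : Type*} (C : Set (ι → ZMod 2)) : Prop :=
  ∀ x ∈ dualCode C, x ≠ 0 → 3 ≤ wt x

/-- `d` is the minimum distance of `C`: the least Hamming weight of a nonzero codeword. -/
def IsMinDist {ι : Type*} (C : Set (ι → ZMod 2)) (d : ℕ) : Prop :=
  (∃ c ∈ C, c ≠ 0 ∧ wt c = d) ∧ ∀ c ∈ C, c ≠ 0 → d ≤ wt c

/-- The number of nonzero Hamming weights occurring among codewords of `C`. -/
noncomputable def numNonzeroWeights {ι : Type*} (C : Set (ι → ZMod 2)) : ℕ :=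
  Nat.card {i : ℕ | 1 ≤ i ∧ weightCount C i ≠ 0}

/-- The codewords of weight `w` in `C` hold a 2-design with index `lam`: every pair of
distinct coordinate positions lies in the support of exactly `lam` codewords of weight `w`. -/
def HoldsTwoDesign {ι : Type*} (C : Set (ι → ZMod 2)) (w lam : ℕ) : Prop :=
  ∀ p q : ι, p ≠ q →
    Nat.card {c : ι → ZMod 2 // c ∈ C ∧ wt c = w ∧ c p ≠ 0 ∧ c q ≠ 0} = lam

/-- The defining set `D_ρ = {x ∈ F_{2^m} : Tr(x) = 1, Tr(x^{2^u+1}) = ρ}`. -/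
def Dset (m u : ℕ) (ρ : ZMod 2) : Set (GaloisField 2 m) :=
  {x | Algebra.trace (ZMod 2) (GaloisField 2 m) x = 1 ∧
       Algebra.trace (ZMod 2) (GaloisField 2 m) (x ^ (2 ^ u + 1)) = ρ}

/-- The linear map `b ↦ (Tr(b·d))_{d ∈ D_ρ}`. -/
noncomputable def codeMap (m u : ℕ) (ρ : ZMod 2) :
    GaloisField 2 m →ₗ[ZMod 2] (↥(Dset m u ρ) → ZMod 2) :=
  LinearMap.pi fun d =>
    (Algebra.trace (ZMod 2) (GaloisField 2 m)).comp
      (LinearMap.mulRight (ZMod 2) (d : GaloisField 2 m))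

/-- The code `C_{D_ρ} = {(Tr(b·d))_{d ∈ D_ρ} : b ∈ F_{2^m}}`. -/
noncomputable def codeD (m u : ℕ) (ρ : ZMod 2) :
    Submodule (ZMod 2) (↥(Dset m u ρ) → ZMod 2) :=
  LinearMap.range (codeMap m u ρ)

section helpers
open Finset

/-- The additive character of `F_2`. -/
def sg (t : ZMod 2) : ℤ := if t = 0 then 1 else -1

lemma sg_zero : sg 0 = 1 := rfl
lemma sg_one : sg 1 = -1 := rfl
lemma sg_add : ∀ a b : ZMod 2, sg (a + b) = sg a * sg b := by decide
lemma sg_mul_self : ∀ a : ZMod 2, sg a * sg a = 1 := by decide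
lemma zmod2_cases : ∀ a : ZMod 2, a = 0 ∨ a = 1 := by decide

section field
variable {K : Type} [Field K] [Fintype K] [Algebra (ZMod 2) K]

/-- Absolute trace. -/
noncomputable abbrev tr (x : K) : ZMod 2 := Algebra.trace (ZMod 2) K x

lemma charTwo (K : Type) [Field K] [Algebra (ZMod 2) K] : CharP K 2 :=
  charP_of_injective_algebraMap (algebraMap (ZMod 2) K).injective 2

lemma tr_sq (x : K) : tr (x ^ 2) = tr x := by
  have := charTwo K
  have h := Algebra.trace_eq_of_algEquiv (FiniteField.frobeniusAlgEquiv (ZMod 2) K 2) x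
  simpa using h

lemma tr_pow (u : ℕ) (x : K) : tr (x ^ 2 ^ u) = tr x := by
  induction u with
  | zero => simp
  | succ u ih => rw [pow_succ, pow_mul, tr_sq, ih]

lemma exists_tr (a : K) (ha : a ≠ 0) : ∃ b : K, tr (a * b) = 1 := by
  by_contra! hf
  apply ha
  apply (traceForm_nondegenerate (ZMod 2) K).1 a
  intro y
  rw [Algebra.traceForm_apply]
  rcases zmod2_cases (tr (a * y)) with h | h
  · exact h
  · exact absurd h (hf y)

lemma sum_sg_tr [DecidableEq K] (a : K) : ∑ x : K, sg (tr (x * a)) = if a = 0 then (Fintype.card K : ℤ) else 0 := by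
  split_ifs with h
  · subst h; simp [sg_zero]
  · obtain ⟨b, hb⟩ := exists_tr a h
    have h1 : ∑ x : K, sg (tr (x * a)) = ∑ x : K, sg (tr ((x + b) * a)) :=
      (Equiv.sum_comp (Equiv.addRight b) (fun x => sg (tr (x * a)))).symm
    have h2 : ∀ x : K, sg (tr ((x + b) * a)) = - sg (tr (x * a)) := by
      intro x
      rw [add_mul, tr, map_add, sg_add, mul_comm b a, show Algebra.trace (ZMod 2) K (a*b) = 1 from hb, sg_one]
      ring
    simp_rw [h2, Finset.sum_neg_distrib] at h1
    linarith

/-- Gold character sum. -/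
noncomputable def gS (K : Type) [Field K] [Fintype K] [Algebra (ZMod 2) K] (u : ℕ) (b : K) : ℤ :=
  ∑ x : K, sg (tr (x ^ (2 ^ u + 1)) + tr (x * b))

lemma tr_one {m : ℕ} (hm : Odd m) (hK : Fintype.card K = 2 ^ m) : tr (1 : K) = 1 := by
  have h := Algebra.trace_algebraMap (R := ZMod 2) (S := K) 1
  rw [map_one] at h
  have h2 : Module.finrank (ZMod 2) K = m := by
    have := FiniteField.pow_finrank_eq_card 2 K
    rw [hK] at this
    exact Nat.pow_right_injective le_rfl this
  rw [tr, h, h2]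
  obtain ⟨k, rfl⟩ := hm
  have : (2 : ZMod 2) = 0 := rfl
  simp [this]

lemma fixed_of {m u : ℕ} (hm : Odd m) (hu : Nat.gcd u m = 1) (hK : Fintype.card K = 2 ^ m)
    (z : K) (hz : z ^ 2 ^ (2 * u) = z) : z = 0 ∨ z = 1 := by
  have key : ∀ k : ℕ, (fun x : K => x ^ 2)^[k] z = z ^ 2 ^ k := by
    intro k
    induction k with
    | zero => simp
    | succ k ih => rw [Function.iterate_succ_apply', ih, ← pow_mul, pow_succ]
  have h1 : Function.IsPeriodicPt (fun x : K => x ^ 2) (2 * u) z := by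
    rw [Function.IsPeriodicPt, Function.IsFixedPt, key, hz]
  have h2 : Function.IsPeriodicPt (fun x : K => x ^ 2) m z := by
    rw [Function.IsPeriodicPt, Function.IsFixedPt, key, ← hK, FiniteField.pow_card]
  have h3 := h1.gcd h2
  have : Nat.gcd (2 * u) m = 1 := by
    apply Nat.Coprime.mul_left
    · exact (Nat.coprime_two_left).2 hm
    · exact hu
  rw [this, Function.IsPeriodicPt, Function.IsFixedPt, key] at h3
  have h4 : z * (z - 1) = 0 := by linear_combination h3
  rcases mul_eq_zero.1 h4 with h | h
  · exact Or.inl h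
  · exact Or.inr (sub_eq_zero.1 h)

lemma polar (u : ℕ) (x z : K) : tr ((x + z) ^ (2 ^ u + 1)) =
    tr (x ^ (2 ^ u + 1)) + tr (z ^ (2 ^ u + 1)) + tr (x ^ 2 ^ u * (z + z ^ 2 ^ (2 * u))) := by
  have := charTwo K
  have h1 : (x + z) ^ (2 ^ u + 1) = x ^ (2 ^ u + 1) + z ^ (2 ^ u + 1) + x ^ 2 ^ u * z + x * z ^ 2 ^ u := by
    rw [pow_succ, add_pow_char_pow]; ring
  have h2 : tr (x * z ^ 2 ^ u) = tr (x ^ 2 ^ u * z ^ 2 ^ (2 * u)) := by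
    rw [← tr_pow u (x * z ^ 2 ^ u), mul_pow, ← pow_mul, ← pow_add, two_mul]
  rw [h1, tr, map_add, map_add, map_add, show Algebra.trace (ZMod 2) K (x * z ^ 2 ^ u) = _ from h2, mul_add, tr, tr, tr, tr, map_add]
  ring

lemma pow_bij (u : ℕ) : Function.Bijective (fun x : K => x ^ 2 ^ u) := by
  have := charTwo K
  have : Function.Injective (fun x : K => x ^ 2 ^ u) := (iterateFrobenius K 2 u).injective
  exact Finite.injective_iff_bijective.1 this

lemma gS_sq {m u : ℕ} (hm : Odd m) (hu : Nat.gcd u m = 1) (hK : Fintype.card K = 2 ^ m) (b : K) :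
    gS K u b ^ 2 = if tr b = 1 then 2 ^ (m + 1) else 0 := by
  classical
  have := charTwo K
  have h1 : gS K u b ^ 2 = ∑ z : K, sg (tr (z ^ (2 ^ u + 1)) + tr (z * b)) *
      ∑ x : K, sg (tr (x ^ 2 ^ u * (z + z ^ 2 ^ (2 * u)))) := by
    have : ∀ x : K, gS K u b = ∑ z : K, sg (tr ((x + z) ^ (2 ^ u + 1)) + tr ((x + z) * b)) := by
      intro x
      exact (Equiv.sum_comp (Equiv.addLeft x) (fun x => sg (tr (x ^ (2 ^ u + 1)) + tr (x * b)))).symm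
    have e : gS K u b ^ 2 = ∑ x : K, sg (tr (x ^ (2 ^ u + 1)) + tr (x * b)) * gS K u b := by
      rw [← Finset.sum_mul, sq]; rfl
    rw [e, Finset.sum_congr rfl (fun x _ => by rw [this x])]
    simp_rw [Finset.mul_sum]
    rw [Finset.sum_comm]
    refine Finset.sum_congr rfl fun z _ => Finset.sum_congr rfl fun x _ => ?_
    rw [polar, add_mul, show tr (x * b + z * b) = tr (x * b) + tr (z * b) from map_add _ _ _]
    simp only [sg_add]
    linear_combination (sg (tr (z ^ (2 ^ u + 1))) * sg (tr (x ^ 2 ^ u * (z + z ^ 2 ^ (2 * u)))) *  sg (tr (z * b))) * (sg (tr (x ^ (2 ^ u + 1))) * sg (tr (x ^ (2 ^ u + 1))) * sg_mul_self (tr (x * b)) + sg_mul_self (tr (x ^ (2 ^ u + 1))))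
  have h2 : ∀ z : K, ∑ x : K, sg (tr (x ^ 2 ^ u * (z + z ^ 2 ^ (2 * u)))) =
      if z = 0 ∨ z = 1 then (2 : ℤ) ^ m else 0 := by
    intro z
    have := Function.Bijective.sum_comp (pow_bij (K := K) u) (fun y => sg (tr (y * (z + z ^ 2 ^ (2 * u)))))
    rw [this, sum_sg_tr, hK]
    have : z + z ^ 2 ^ (2 * u) = 0 ↔ z = 0 ∨ z = 1 := by
      constructor
      · intro h
        apply fixed_of hm hu hK
        exact (CharTwo.add_eq_zero.1 h).symm
      · rintro (rfl | rfl)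
        · simp
        · simp [CharTwo.add_self_eq_zero]
    simp [this]
  rw [h1]
  simp_rw [h2]
  simp only [mul_ite, mul_zero]
  rw [← Finset.sum_filter]
  have : (Finset.univ.filter fun z : K => z = 0 ∨ z = 1) = {0, 1} := by ext; simp
  rw [this, Finset.sum_pair zero_ne_one]
  have t1 := tr_one hm hK
  rcases zmod2_cases (tr b) with h | h
  · simp [h, t1, sg_add, sg_zero, sg_one]
  · simp [h, t1, sg_add, sg_zero, sg_one]; ring


lemma gS_eq_card (u : ℕ) (b : K) : gS K u b =
    2 * (Nat.card {x : K // tr (x ^ (2 ^ u + 1)) + tr (x * b) = 0} : ℤ) - Fintype.card K := by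
  classical
  have h : ∀ t : ZMod 2, sg t = 2 * (if t = 0 then 1 else 0) - 1 := by decide
  rw [gS]
  simp_rw [h]
  rw [Finset.sum_sub_distrib, ← Finset.mul_sum, Finset.sum_boole, Nat.card_eq_fintype_card,
    Fintype.card_subtype]
  simp

lemma card_descend {p k u : ℕ} [Fact p.Prime] (hp : Odd p) (hk : k ≠ 0)
    (hK : Fintype.card K = 2 ^ (p * k)) :
    Nat.card {x : K // tr (x ^ (2 ^ u + 1)) + tr (x * 1) = 0} ≡
    Nat.card {x : GaloisField 2 k // tr (x ^ (2 ^ u + 1)) + tr (x * 1) = 0} [MOD p] := by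
  classical
  have hfK : Module.finrank (ZMod 2) K = p * k := by
    have := FiniteField.pow_finrank_eq_card 2 K
    rw [hK] at this
    exact Nat.pow_right_injective le_rfl this
  have hfL : Module.finrank (ZMod 2) (GaloisField 2 k) = k := GaloisField.finrank 2 hk
  obtain ⟨φ⟩ := FiniteField.nonempty_algHom_of_finrank_dvd (F := ZMod 2) (K := GaloisField 2 k)
    (L := K) (by rw [hfK, hfL]; exact dvd_mul_left _ _)
  letI : Fintype (GaloisField 2 k) := Fintype.ofFinite _
  have hcL : Fintype.card (GaloisField 2 k) = 2 ^ k := by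
    rw [← Nat.card_eq_fintype_card, GaloisField.card 2 k hk]
  have htr : ∀ y : GaloisField 2 k, tr (φ y) = tr y := by
    letI : Algebra (GaloisField 2 k) K := φ.toRingHom.toAlgebra
    haveI : IsScalarTower (ZMod 2) (GaloisField 2 k) K :=
      IsScalarTower.of_algebraMap_eq fun x => (φ.commutes x).symm
    have hLK : Module.finrank (GaloisField 2 k) K = p := by
      have := Module.finrank_mul_finrank (ZMod 2) (GaloisField 2 k) K
      rw [hfK, hfL, mul_comm p k] at this
      exact Nat.eq_of_mul_eq_mul_left (Nat.pos_of_ne_zero hk) this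
    intro y
    rw [tr, ← Algebra.trace_trace (S := GaloisField 2 k)]
    have : Algebra.trace (GaloisField 2 k) K (φ y) = y := by
      have h := Algebra.trace_algebraMap (R := GaloisField 2 k) (S := K) y
      rw [hLK] at h
      refine Eq.trans h ?_
      obtain ⟨j, rfl⟩ := hp
      have := charTwo (GaloisField 2 k)
      rw [add_smul, mul_smul, two_smul, CharTwo.add_self_eq_zero, zero_add, one_smul]
    rw [this]
  have hrange : ∀ x : K, x ^ 2 ^ k = x → ∃ y, φ y = x := by
    intro x hx
    have hP : (Polynomial.X ^ 2 ^ k - Polynomial.X : Polynomial K) ≠ 0 :=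
      FiniteField.X_pow_card_pow_sub_X_ne_zero K hk one_lt_two
    have hsub : (Finset.univ.image φ) ⊆ (Polynomial.X ^ 2 ^ k - Polynomial.X : Polynomial K).roots.toFinset := by
      intro z hz
      obtain ⟨y, -, rfl⟩ := Finset.mem_image.1 hz
      rw [Multiset.mem_toFinset, Polynomial.mem_roots hP]
      simp only [Polynomial.IsRoot.def, Polynomial.eval_sub, Polynomial.eval_pow, Polynomial.eval_X]
      rw [← map_pow, ← hcL, FiniteField.pow_card, sub_self]
    have hcard : (Polynomial.X ^ 2 ^ k - Polynomial.X : Polynomial K).roots.toFinset.card ≤ (Finset.univ.image φ).card := by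
      rw [Finset.card_image_of_injective _ (show Function.Injective (φ : GaloisField 2 k → K) from φ.injective),
        Finset.card_univ, hcL]
      refine (Multiset.toFinset_card_le _).trans ((Polynomial.card_roots' _).trans ?_)
      rw [FiniteField.X_pow_card_pow_sub_X_natDegree_eq K hk one_lt_two]
    have := Finset.eq_of_subset_of_card_le hsub hcard
    have hx' : x ∈ (Finset.univ.image φ) := by
      rw [this, Multiset.mem_toFinset, Polynomial.mem_roots hP]
      simp [hx]
    obtain ⟨y, -, hy⟩ := Finset.mem_image.1 hx'
    exact ⟨y, hy⟩
  let f : Function.End {x : K // tr (x ^ (2 ^ u + 1)) + tr (x * 1) = 0} := fun x =>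
    ⟨x.1 ^ 2 ^ k, by
      have := x.2
      rw [mul_one] at this ⊢
      rw [← pow_mul, mul_comm, pow_mul, tr_pow, tr_pow, this]⟩
  have hf : f ^ p ^ 1 = 1 := by
    rw [pow_one]
    have key : ∀ j x, ((f ^ j) x).1 = x.1 ^ 2 ^ (j * k) := by
      intro j
      induction j with
      | zero =>
        intro x
        rw [pow_zero, zero_mul, pow_zero, pow_one]
        rfl
      | succ j ih =>
        intro x
        rw [pow_succ]
        change ((f ^ j) (f x)).1 = _
        rw [ih]
        change (x.1 ^ 2 ^ k) ^ 2 ^ (j * k) = _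
        rw [← pow_mul, ← pow_add]
        congr 2; ring
    funext x
    apply Subtype.ext
    rw [key, ← hK, FiniteField.pow_card]
    rfl
  have hmain := Equiv.Perm.card_fixedPoints_modEq hf
  rw [Nat.card_eq_fintype_card]
  refine hmain.trans ?_
  rw [← Nat.card_eq_fintype_card]
  have e : {x : GaloisField 2 k // tr (x ^ (2 ^ u + 1)) + tr (x * 1) = 0} ≃ f.fixedPoints := by
    refine Equiv.ofBijective (fun y => ⟨⟨φ y.1, ?_⟩, ?_⟩) ⟨?_, ?_⟩
    · rw [← map_pow, ← map_one φ, ← map_mul, htr, htr, y.2]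
    · apply Subtype.ext
      change (φ y.1) ^ 2 ^ k = φ y.1
      rw [← map_pow, ← hcL, FiniteField.pow_card]
    · intro a b h
      apply Subtype.ext
      apply φ.injective
      exact congrArg (fun z => z.1.1) h
    · rintro ⟨⟨x, hx⟩, hx2⟩
      have : x ^ 2 ^ k = x := congrArg Subtype.val hx2
      obtain ⟨y, rfl⟩ := hrange x this
      refine ⟨⟨y, ?_⟩, rfl⟩
      rw [← htr, ← htr, map_pow, map_mul, map_one, hx]
  rw [Nat.card_congr e]

end field

lemma chi8_sq {m : ℕ} (hm : Odd m) : ZMod.χ₈ m = 1 ∨ ZMod.χ₈ m = -1 := by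
  rw [ZMod.χ₈_nat_eq_if_mod_eight]
  have : m % 2 = 1 := Nat.odd_iff.1 hm
  simp only [this]
  split_ifs <;> simp_all

theorem gS_one (m : ℕ) : Odd m → ∀ (K : Type) [Field K] [Fintype K] [Algebra (ZMod 2) K] (u : ℕ),
    Nat.gcd u m = 1 → Fintype.card K = 2 ^ m → gS K u 1 = ZMod.χ₈ m * 2 ^ ((m + 1) / 2) := by
  induction m using Nat.strong_induction_on with
  | _ m ih =>
  intro hm K _ _ _ u hu hK
  by_cases h1 : m = 1
  · subst h1
    have t1 := tr_one hm hK
    have hx : ∀ x : K, x = 0 ∨ x = 1 := by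
      intro x
      have := FiniteField.pow_card x
      rw [hK] at this
      have h4 : x * (x - 1) = 0 := by linear_combination this
      rcases mul_eq_zero.1 h4 with h | h
      · exact Or.inl h
      · exact Or.inr (sub_eq_zero.1 h)
    classical
    have : (Finset.univ : Finset K) = {0, 1} := by ext x; simp [hx x]
    rw [gS, this, Finset.sum_pair zero_ne_one]
    simp [t1, sg_add, sg_one, sg_zero]
  · obtain ⟨p, hpp, hpm⟩ := Nat.exists_prime_and_dvd h1
    obtain ⟨k, rfl⟩ := hpm
    have : Fact p.Prime := ⟨hpp⟩
    have hpo : Odd p := (Nat.odd_mul.1 hm).1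
    have hko : Odd k := (Nat.odd_mul.1 hm).2
    have hk0 : k ≠ 0 := by rintro rfl; simp at hko
    letI : Fintype (GaloisField 2 k) := Fintype.ofFinite _
    have hcL : Fintype.card (GaloisField 2 k) = 2 ^ k := by
      rw [← Nat.card_eq_fintype_card, GaloisField.card 2 k hk0]
    have hlt : k < p * k := by
      have := hpp.two_le
      have := Nat.pos_of_ne_zero hk0
      nlinarith
    have ihk := ih k hlt hko (GaloisField 2 k) u (Nat.Coprime.coprime_mul_left_right hu) hcL
    have hmod := card_descend (K := K) (u := u) hpo hk0 hK
    have hmod2 := (ZMod.natCast_eq_natCast_iff _ _ _).2 hmod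
    have e1 := congrArg (Int.cast : ℤ → ZMod p) (gS_eq_card u (1 : K))
    have e2 := congrArg (Int.cast : ℤ → ZMod p) (gS_eq_card u (1 : GaloisField 2 k))
    rw [hK] at e1
    rw [hcL] at e2
    push_cast at e1 e2
    rw [hmod2, mul_comm p k, pow_mul, ZMod.pow_card, ← e2, ihk] at e1
    have hsq := gS_sq hm hu hK 1
    rw [if_pos (tr_one hm hK)] at hsq
    have hsq' : gS K u 1 ^ 2 = (2 ^ ((p * k + 1) / 2)) ^ 2 := by
      rw [hsq, ← pow_mul]
      congr 1
      obtain ⟨j, hj⟩ := hm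
      omega
    have hexp : (p * k + 1) / 2 = (k + 1) / 2 + (p / 2) * k := by
      obtain ⟨i, rfl⟩ := hpo
      obtain ⟨j, rfl⟩ := hko
      have a1 : ((2 * i + 1) * (2 * j + 1) + 1) = 2 * (j + 1 + i * (2 * j + 1)) := by ring
      have a2 : (2 * j + 1 + 1) = 2 * (j + 1) := by ring
      have a3 : (2 * i + 1) / 2 = i := by omega
      rw [a1, a2, a3]
      simp
    have hp2 : p ≠ 2 := by rintro rfl; exact absurd hpo (by decide)
    have hleg : ((ZMod.χ₈ p : ℤ) : ZMod p) = (2 : ZMod p) ^ (p / 2) := by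
      have := legendreSym.eq_pow p 2
      rw [legendreSym.at_two hp2] at this
      simpa using this
    have h2 : (2 : ZMod p) ≠ 0 := by
      intro h
      have : ((2 : ℕ) : ZMod p) = 0 := by exact_mod_cast h
      rw [ZMod.natCast_eq_zero_iff] at this
      have := Nat.le_of_dvd (by norm_num) this
      have := hpp.two_le
      omega
    have hpk : ZMod.χ₈ ((p * k : ℕ) : ZMod 8) = ZMod.χ₈ p * ZMod.χ₈ k := by
      rw [Nat.cast_mul, map_mul]
    have hcp : ((ZMod.χ₈ p : ℤ) : ZMod p) ^ k = ((ZMod.χ₈ p : ℤ) : ZMod p) := by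
      rcases chi8_sq hpo with h | h
      · simp [h]
      · simp [h, hko.neg_one_pow]
    have hne : ∀ e : ℤ, (e = 1 ∨ e = -1) → gS K u 1 = e * 2 ^ ((p * k + 1) / 2) →
        (e : ZMod p) = ((ZMod.χ₈ p * ZMod.χ₈ k : ℤ) : ZMod p) := by
      intro e he h
      rw [h, hexp] at e1
      push_cast at e1
      rw [pow_add, pow_mul, ← hleg, hcp] at e1
      have e3 : (2 : ZMod p) ^ ((k + 1) / 2) * ((e : ZMod p) * (ZMod.χ₈ p : ℤ)) = (2 : ZMod p) ^ ((k + 1) / 2) * (ZMod.χ₈ k : ℤ) := by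
        linear_combination e1
      have e4 := mul_left_cancel₀ (pow_ne_zero _ h2) e3
      push_cast
      rw [← e4]
      rcases chi8_sq hpo with h | h <;> simp [h]
    have h1m1 : (1 : ZMod p) ≠ -1 := by
      intro h
      apply h2
      linear_combination h
    rw [hpk]
    have hab : ZMod.χ₈ p * ZMod.χ₈ k = 1 ∨ ZMod.χ₈ p * ZMod.χ₈ k = -1 := by
      rcases chi8_sq hpo with h | h <;> rcases chi8_sq hko with h' | h' <;> simp [h, h']
    rcases sq_eq_sq_iff_eq_or_eq_neg.1 hsq' with h | h
    · have := hne 1 (Or.inl rfl) (by rw [h, one_mul])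
      rcases hab with h' | h'
      · rw [h, h', one_mul]
      · rw [h'] at this
        exact absurd (by simpa using this) h1m1
    · have := hne (-1) (Or.inr rfl) (by rw [h]; ring)
      rcases hab with h' | h'
      · rw [h'] at this
        exact absurd (by simpa using this.symm) h1m1
      · rw [h, h']; ring
section coding
open Polynomial

/-- Hamming weight as a finset cardinality. -/
def hw {ι : Type*} [Fintype ι] (c : ι → ZMod 2) : ℕ := #{i | c i ≠ 0}

/-- Character generating polynomial with the coordinates in `T` forced to be nonzero. -/
noncomputable def gp {ι : Type*} [Fintype ι] [DecidableEq ι] (c : ι → ZMod 2) (T : Finset ι) : ℤ[X] :=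
  ∏ i, (if i ∈ T then C (sg (c i)) * X else 1 + C (sg (c i)) * X)

variable {ι : Type} [Fintype ι] [DecidableEq ι]

lemma hw_eq_sum (c : ι → ZMod 2) : hw c = ∑ i, if c i ≠ 0 then 1 else 0 := by
  rw [hw, Finset.card_filter]

lemma hw_le (c : ι → ZMod 2) : hw c ≤ Fintype.card ι := Finset.card_le_univ _

lemma coeff_gp (c : ι → ZMod 2) (T : Finset ι) (w : ℕ) :
    (gp c T).coeff w = ∑ x : ι → ZMod 2 with (hw x = w ∧ ∀ i ∈ T, x i ≠ 0), ∏ i, sg (x i * c i) := by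
  let h : ι → ZMod 2 → ℤ[X] := fun i a =>
    if a ≠ 0 then C (sg (c i)) * X else if i ∈ T then 0 else 1
  have h1 : gp c T = ∏ i, ∑ a ∈ (Finset.univ : Finset (ZMod 2)), h i a := by
    refine Finset.prod_congr rfl fun i _ => ?_
    have : (Finset.univ : Finset (ZMod 2)) = {0, 1} := by decide
    rw [this, Finset.sum_pair (by decide)]
    simp only [h]
    split_ifs <;> simp_all
  rw [h1, Finset.prod_univ_sum, Fintype.piFinset_univ, Polynomial.finsetSum_coeff,
    Finset.sum_filter]
  refine Finset.sum_congr rfl fun x _ => ?_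
  by_cases hT : ∀ i ∈ T, x i ≠ 0
  · have : ∏ i, h i (x i) = C (∏ i, sg (x i * c i)) * X ^ hw x := by
      rw [hw_eq_sum, ← Finset.prod_pow_eq_pow_sum, map_prod, ← Finset.prod_mul_distrib]
      refine Finset.prod_congr rfl fun i _ => ?_
      simp only [h]
      rcases zmod2_cases (x i) with hx | hx
      · have : i ∉ T := fun hi => hT i hi hx
        simp [hx, this, sg_zero]
      · simp [hx]
    rw [this, Polynomial.coeff_C_mul, Polynomial.coeff_X_pow]
    by_cases hw' : hw x = w
    · rw [if_pos hw'.symm, if_pos ⟨hw', hT⟩, mul_one]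
    · rw [if_neg (fun e => hw' e.symm), if_neg (fun e => hw' e.1), mul_zero]
  · rw [if_neg (fun e => hT e.2)]
    push Not at hT
    obtain ⟨i, hi, hx⟩ := hT
    have : ∏ i, h i (x i) = 0 := by
      apply Finset.prod_eq_zero (Finset.mem_univ i)
      simp [h, hi, hx]
    rw [this, Polynomial.coeff_zero]

lemma prod_sg (c : ι → ZMod 2) (S : Finset ι) : ∏ i ∈ S, (1 + C (sg (c i)) * X : ℤ[X]) =
    (1 - X) ^ #{i ∈ S | c i ≠ 0} * (1 + X) ^ #{i ∈ S | ¬ c i ≠ 0} := by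
  rw [← Finset.prod_filter_mul_prod_filter_not S (fun i => c i ≠ 0)]
  congr 1
  · rw [← Finset.prod_const]
    refine Finset.prod_congr rfl fun i hi => ?_
    have : sg (c i) = -1 := if_neg (Finset.mem_filter.1 hi).2
    rw [this]; simp; ring
  · rw [← Finset.prod_const]
    refine Finset.prod_congr rfl fun i hi => ?_
    have : sg (c i) = 1 := if_pos (not_not.1 (Finset.mem_filter.1 hi).2)
    rw [this]; simp

lemma gp_empty (c : ι → ZMod 2) :
    gp c ∅ = (1 - X) ^ hw c * (1 + X) ^ (Fintype.card ι - hw c) := by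
  have h := Finset.card_filter_add_card_filter_not (s := (Finset.univ : Finset ι)) (fun i => c i ≠ 0)
  rw [Finset.card_univ] at h
  have : gp c ∅ = ∏ i, (1 + C (sg (c i)) * X : ℤ[X]) := by simp [gp]
  rw [this, prod_sg]
  congr 2
  rw [hw]; omega

/-- The polynomial attached to a pair of forced coordinates. -/
noncomputable def gG (n : ℕ) (α β : ZMod 2) (w : ℕ) : ℤ[X] :=
  (C (sg α) * X) * (C (sg β) * X) *
    ((1 - X) ^ (w - (if α ≠ 0 then 1 else 0) - (if β ≠ 0 then 1 else 0)) *
     (1 + X) ^ (n - w - (if ¬ α ≠ 0 then 1 else 0) - (if ¬ β ≠ 0 then 1 else 0)))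

lemma gp_pair (c : ι → ZMod 2) (p q : ι) (hpq : p ≠ q) :
    gp c {p, q} = gG (Fintype.card ι) (c p) (c q) (hw c) := by
  have hS : (Finset.univ : Finset ι) = insert p (insert q ((Finset.univ.erase p).erase q)) := by
    ext i; simp; tauto
  set S := (Finset.univ.erase p).erase q with hSdef
  have hp : p ∉ insert q S := by simp [hSdef, hpq]
  have hq : q ∉ S := by simp [hSdef]
  have e1 : gp c {p, q} = (C (sg (c p)) * X) * (C (sg (c q)) * X) * ∏ i ∈ S, (1 + C (sg (c i)) * X : ℤ[X]) := by
    have hP : ∏ i ∈ S, (if i ∈ ({p, q} : Finset ι) then C (sg (c i)) * X else 1 + C (sg (c i)) * X : ℤ[X]) =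
        ∏ i ∈ S, (1 + C (sg (c i)) * X : ℤ[X]) := by
      refine Finset.prod_congr rfl fun i hi => ?_
      rw [if_neg]
      simp [hSdef] at hi
      simp [hi]
    rw [gp, hS, Finset.prod_insert hp, Finset.prod_insert hq, if_pos (by simp), if_pos (by simp), hP]
    ring
  have h := Finset.card_filter_add_card_filter_not (s := (Finset.univ : Finset ι)) (fun i => c i ≠ 0)
  rw [Finset.card_univ] at h
  have c1 : hw c = (if c p ≠ 0 then 1 else 0) + ((if c q ≠ 0 then 1 else 0) + #{i ∈ S | c i ≠ 0}) := by
    rw [hw, hS, Finset.card_filter, Finset.sum_insert hp, Finset.sum_insert hq, ← Finset.card_filter]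
  have c2 : #{i : ι | ¬ c i ≠ 0} = (if ¬ c p ≠ 0 then 1 else 0) + ((if ¬ c q ≠ 0 then 1 else 0) + #{i ∈ S | ¬ c i ≠ 0}) := by
    conv_lhs => rw [hS, Finset.card_filter, Finset.sum_insert hp, Finset.sum_insert hq, ← Finset.card_filter]
  rw [e1, prod_sg, gG]
  have c3 : Fintype.card ι - hw c = #{i : ι | ¬ c i ≠ 0} := by rw [hw]; omega
  rw [c3, c2, c1]
  congr 3 <;> omega

lemma design_count (W : Finset (ι → ZMod 2)) (w lam : ℕ) (hW : ∀ x ∈ W, hw x = w)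
    (hl : ∀ p q : ι, p ≠ q → #{x ∈ W | x p ≠ 0 ∧ x q ≠ 0} = lam) :
    lam * (Fintype.card ι * (Fintype.card ι - 1)) = w * (w - 1) * #W := by
  have h1 : ∑ z ∈ (Finset.univ : Finset ι).offDiag, #{x ∈ W | x z.1 ≠ 0 ∧ x z.2 ≠ 0} =
      ∑ x ∈ W, #(({i | x i ≠ 0} : Finset ι).offDiag) := by
    simp_rw [Finset.card_filter]
    rw [Finset.sum_comm]
    refine Finset.sum_congr rfl fun x _ => ?_
    rw [← Finset.card_filter]
    congr 1
    ext z
    simp only [Finset.mem_filter, Finset.mem_offDiag, Finset.mem_univ, true_and]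
    tauto
  have h2 : ∑ z ∈ (Finset.univ : Finset ι).offDiag, #{x ∈ W | x z.1 ≠ 0 ∧ x z.2 ≠ 0} =
      ∑ z ∈ (Finset.univ : Finset ι).offDiag, lam :=
    Finset.sum_congr rfl (fun z hz => hl z.1 z.2 (Finset.mem_offDiag.1 hz).2.2)
  have h3 : ∑ x ∈ W, #(({i | x i ≠ 0} : Finset ι).offDiag) = ∑ x ∈ W, (w * w - w) :=
    Finset.sum_congr rfl (fun x hx => by
      rw [Finset.offDiag_card]
      have := hW x hx
      rw [hw] at this
      rw [this])
  rw [h2, h3, Finset.sum_const, Finset.sum_const, Finset.offDiag_card, Finset.card_univ] at h1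
  simp only [smul_eq_mul] at h1
  rw [Nat.mul_sub_one, Nat.mul_sub_one, mul_comm lam, h1, mul_comm]

end coding
section combine
open Polynomial
variable {K : Type} [Field K] [Fintype K] [Algebra (ZMod 2) K] [DecidableEq K]
variable {ι : Type} [Fintype ι] [DecidableEq ι]

/-- The codeword attached to `b`. -/
noncomputable def cw (e : ι → K) (b : K) (i : ι) : ZMod 2 := tr (b * e i)

lemma sg_sum {κ : Type} (S : Finset κ) (f : κ → ZMod 2) : sg (∑ i ∈ S, f i) = ∏ i ∈ S, sg (f i) := by
  classical
  induction S using Finset.induction_on with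
  | empty => simp [sg_zero]
  | insert a S ha ih => rw [Finset.sum_insert ha, Finset.prod_insert ha, sg_add, ih]

lemma inner_eq (e : ι → K) (b : K) (x : ι → ZMod 2) :
    ∑ i, x i * cw e b i = tr (b * ∑ i, x i • e i) := by
  rw [Finset.mul_sum, tr, map_sum]
  refine Finset.sum_congr rfl fun i _ => ?_
  rw [mul_smul_comm, map_smul, smul_eq_mul, cw]

lemma dual_count (e : ι → K) (P : (ι → ZMod 2) → Prop) [DecidablePred P] :
    (Fintype.card K : ℤ) * #{x : ι → ZMod 2 | (∑ i, x i • e i = 0) ∧ P x} =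
      ∑ b : K, ∑ x : ι → ZMod 2 with P x, ∏ i, sg (x i * cw e b i) := by
  rw [Finset.sum_comm, Finset.card_filter]
  push_cast
  rw [Finset.mul_sum, Finset.sum_filter]
  refine Finset.sum_congr rfl fun x _ => ?_
  simp_rw [← sg_sum, inner_eq, sum_sg_tr]
  split_ifs <;> simp_all

lemma sum_v_eq (e : ι → K) (b : K) :
    ∑ i, sg (cw e b i) = (Fintype.card ι : ℤ) - 2 * hw (cw e b) := by
  have h : ∀ t : ZMod 2, sg t = 1 - 2 * (if t ≠ 0 then 1 else 0) := by decide
  simp_rw [h]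
  rw [Finset.sum_sub_distrib, ← Finset.mul_sum, Finset.sum_boole, hw]
  simp

lemma moment (e : ι → K) (he : Function.Injective e) (ht : ∀ i, tr (e i) = 1) (p q : ι) (hpq : p ≠ q)
    (σ σ' E τ : ℤ) :
    ∑ b : K, (1 + σ * sg (cw e b p)) * (1 + σ' * sg (cw e b q)) * (E + τ * ∑ i, sg (cw e b i)) =
      Fintype.card K * (E + τ * (σ + σ')) := by
  classical
  have hchar := charTwo K
  have ne0 : ∀ i, e i ≠ 0 := by
    intro i h
    have := ht i
    rw [h] at this
    simp at this
  have m1 : ∀ i, ∑ b : K, sg (cw e b i) = 0 := by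
    intro i
    simp only [cw]
    rw [sum_sg_tr, if_neg (ne0 i)]
  have m2 : ∀ i j, ∑ b : K, sg (cw e b i) * sg (cw e b j) = if i = j then (Fintype.card K : ℤ) else 0 := by
    intro i j
    simp only [cw, ← sg_add]
    have : ∀ b : K, tr (b * e i) + tr (b * e j) = tr (b * (e i + e j)) := by
      intro b; rw [mul_add]; exact (map_add _ _ _).symm
    simp_rw [this]
    rw [sum_sg_tr]
    congr 1
    rw [CharTwo.add_eq_zero, he.eq_iff]
  have m3 : ∀ i j k, ∑ b : K, sg (cw e b i) * sg (cw e b j) * sg (cw e b k) = 0 := by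
    intro i j k
    simp only [cw, ← sg_add]
    have : ∀ b : K, tr (b * e i) + tr (b * e j) + tr (b * e k) = tr (b * (e i + e j + e k)) := by
      intro b; simp only [mul_add, tr, map_add]
    simp_rw [this]
    rw [sum_sg_tr, if_neg]
    intro h
    have h2 : tr (e i + e j + e k) = 0 := by rw [h]; simp
    have h3 : tr (e i + e j + e k) = tr (e i) + tr (e j) + tr (e k) := by
      simp only [tr, map_add]
    rw [h3, ht, ht, ht] at h2
    exact absurd h2 (by decide)
  have v1 : ∑ b : K, ∑ i, sg (cw e b i) = 0 := by
    rw [Finset.sum_comm]; simp [m1]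
  have v2 : ∀ p, ∑ b : K, sg (cw e b p) * ∑ i, sg (cw e b i) = Fintype.card K := by
    intro p
    simp_rw [Finset.mul_sum]
    rw [Finset.sum_comm]; simp [m2]
  have v3 : ∑ b : K, sg (cw e b p) * sg (cw e b q) * ∑ i, sg (cw e b i) = 0 := by
    simp_rw [Finset.mul_sum]
    rw [Finset.sum_comm]; simp [m3]
  have hexp : ∀ b : K, (1 + σ * sg (cw e b p)) * (1 + σ' * sg (cw e b q)) * (E + τ * ∑ i, sg (cw e b i)) =
      E + E * σ * sg (cw e b p) + E * σ' * sg (cw e b q) + E * σ * σ' * (sg (cw e b p) * sg (cw e b q))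
      + τ * (∑ i, sg (cw e b i)) + τ * σ * (sg (cw e b p) * ∑ i, sg (cw e b i))
      + τ * σ' * (sg (cw e b q) * ∑ i, sg (cw e b i))
      + τ * σ * σ' * (sg (cw e b p) * sg (cw e b q) * ∑ i, sg (cw e b i)) := by
    intro b; ring
  rw [Finset.sum_congr rfl (fun b _ => hexp b)]
  simp only [Finset.sum_add_distrib, ← Finset.mul_sum, m1, m2, v1, v2, v3, if_neg hpq, Finset.sum_const]
  simp
  ring

/-- Interpolation polynomial value. -/
noncomputable def interp (g : ZMod 2 → ZMod 2 → ℕ → ℤ) (n d : ℕ) (s t v : ℤ) : ℤ :=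
  ∑ α : ZMod 2, ∑ β : ZMod 2, ∑ γ : ZMod 2, g α β (if γ = 0 then d else n - d) *
    ((1 + sg α * s) * (1 + sg β * t) * (((n : ℤ) - 2 * d) + sg γ * v))

lemma interp_eq (g : ZMod 2 → ZMod 2 → ℕ → ℤ) (n d : ℕ) (hd : 2 * d < n) (a b : ZMod 2) (w : ℕ)
    (hw : w = d ∨ w = n - d) :
    8 * ((n : ℤ) - 2 * d) * g a b w = interp g n d (sg a) (sg b) (n - 2 * w) := by
  have huniv : (Finset.univ : Finset (ZMod 2)) = {0, 1} := by decide
  unfold interp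
  simp only [huniv, Finset.sum_pair (show (0 : ZMod 2) ≠ 1 by decide), if_pos, if_neg (show ¬ (1 : ZMod 2) = 0 by decide)]
  rcases hw with rfl | rfl
  · rcases zmod2_cases a with rfl | rfl <;> rcases zmod2_cases b with rfl | rfl <;>
      simp only [sg_zero, sg_one] <;> ring
  · have : ((n - d : ℕ) : ℤ) = n - d := by
      rw [Nat.cast_sub]; omega
    rw [this]
    rcases zmod2_cases a with rfl | rfl <;> rcases zmod2_cases b with rfl | rfl <;>
      simp only [sg_zero, sg_one] <;> ring

lemma const_sum (e : ι → K) (he : Function.Injective e) (ht : ∀ i, tr (e i) = 1) (n d : ℕ)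
    (hn : Fintype.card ι = n) (hd : 2 * d < n)
    (hwt : ∀ b : K, b ≠ 0 → b ≠ 1 → hw (cw e b) = d ∨ hw (cw e b) = n - d)
    (h0 : hw (cw e 0) = 0) (h1 : hw (cw e 1) = n)
    (g : ZMod 2 → ZMod 2 → ℕ → ℤ) :
    ∃ Q : ℤ, ∀ p q, p ≠ q → ∑ b : K, g (cw e b p) (cw e b q) (hw (cw e b)) = Q := by
  have key : ∃ Q : ℤ, ∀ p q, p ≠ q →
      8 * ((n : ℤ) - 2 * d) * ∑ b : K, g (cw e b p) (cw e b q) (hw (cw e b)) = Q := by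
    have c0 : ∀ p, cw e 0 p = 0 := fun p => by simp [cw]
    have c1 : ∀ p, cw e 1 p = 1 := fun p => by simp [cw, ht]
    refine ⟨8 * ((n : ℤ) - 2 * d) * (g 0 0 0 + g 1 1 n) - interp g n d 1 1 n - interp g n d (-1) (-1) (-n)
      + ∑ α : ZMod 2, ∑ β : ZMod 2, ∑ γ : ZMod 2, g α β (if γ = 0 then d else n - d) *
    (Fintype.card K * (((n : ℤ) - 2 * d) + sg γ * (sg α + sg β))), ?_⟩
    intro p q hpq
    have hI : ∑ b : K, interp g n d (sg (cw e b p)) (sg (cw e b q)) (∑ i, sg (cw e b i)) =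
        ∑ α : ZMod 2, ∑ β : ZMod 2, ∑ γ : ZMod 2, g α β (if γ = 0 then d else n - d) *
    (Fintype.card K * (((n : ℤ) - 2 * d) + sg γ * (sg α + sg β))) := by
      unfold interp
      rw [Finset.sum_comm]
      refine Finset.sum_congr rfl fun α _ => ?_
      rw [Finset.sum_comm]
      refine Finset.sum_congr rfl fun β _ => ?_
      rw [Finset.sum_comm]
      refine Finset.sum_congr rfl fun γ _ => ?_
      rw [← Finset.mul_sum, moment e he ht p q hpq]
    rw [← hI]
    have hsplit : ∀ f : K → ℤ, ∑ b : K, f b = f 0 + f 1 + ∑ b ∈ (Finset.univ.erase (0 : K)).erase 1, f b := by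
      intro f
      rw [← Finset.add_sum_erase _ f (Finset.mem_univ (0 : K)),
        ← Finset.add_sum_erase (Finset.univ.erase (0 : K)) f (a := 1) (by simp), add_assoc]
    rw [hsplit, hsplit (fun b => interp g n d _ _ _)]
    simp only [sum_v_eq, hn]
    simp only [c0, c1, h0, h1, sg_zero, sg_one]
    have hr : ∑ b ∈ (Finset.univ.erase (0 : K)).erase 1, interp g n d (sg (cw e b p)) (sg (cw e b q)) ((n : ℤ) - 2 * (hw (cw e b)))
        = 8 * ((n : ℤ) - 2 * d) * ∑ b ∈ (Finset.univ.erase (0 : K)).erase 1, g (cw e b p) (cw e b q) (hw (cw e b)) := by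
      rw [Finset.mul_sum]
      refine Finset.sum_congr rfl fun b hb => ?_
      simp at hb
      rw [interp_eq g n d hd _ _ _ (hwt b hb.2 hb.1)]
    rw [hr]
    have e1 : (n : ℤ) - 2 * ((0 : ℕ) : ℤ) = n := by simp
    have e2 : (n : ℤ) - 2 * n = - n := by ring
    rw [e1, e2]
    ring
  obtain ⟨Q, hQ⟩ := key
  by_cases hex : ∃ p q : ι, p ≠ q
  · obtain ⟨p0, q0, h⟩ := hex
    refine ⟨∑ b : K, g (cw e b p0) (cw e b q0) (hw (cw e b)), fun p q hpq => ?_⟩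
    have := (hQ p q hpq).trans (hQ p0 q0 h).symm
    refine mul_left_cancel₀ ?_ this
    have : (2 * d : ℤ) < n := by exact_mod_cast hd
    intro h
    linarith
  · push Not at hex
    exact ⟨0, fun p q hpq => absurd (hex p q) hpq⟩

lemma coeff_symm (n w r : ℕ) (hw : w ≤ n) :
    ((1 - X : ℤ[X]) ^ (n - w) * (1 + X) ^ (n - (n - w))).coeff (2 * r) =
    ((1 - X : ℤ[X]) ^ w * (1 + X) ^ (n - w)).coeff (2 * r) := by
  have h : ((1 - X : ℤ[X]) ^ (n - w) * (1 + X) ^ (n - (n - w))) =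
      ((1 - X : ℤ[X]) ^ w * (1 + X) ^ (n - w)).comp (-X) := by
    rw [Nat.sub_sub_self hw]
    simp
    ring
  rw [h, show (-X : ℤ[X]) = C (-1) * X by simp, Polynomial.comp_C_mul_X_coeff]
  simp

lemma coeff_kraw (n d r J : ℕ) (hd : 2 * d ≤ n) (hJ : n - 2 * d < 2 * J + 2) :
    ((1 - X : ℤ[X]) ^ d * (1 + X) ^ (n - d)).coeff (2 * r) =
      ∑ p ∈ (Finset.range (d + 1) ×ˢ Finset.range (J + 1)).filter (fun p => p.1 + p.2 = r),
            (-1 : ℤ) ^ p.1 * (d.choose p.1) * ((n - 2 * d).choose (2 * p.2)) := by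
  have h1 : (1 - X : ℤ[X]) ^ d * (1 + X) ^ (n - d) = (-X ^ 2 + 1) ^ d * (1 + X) ^ (n - 2 * d) := by
    have : n - d = d + (n - 2 * d) := by omega
    rw [this, pow_add, ← mul_assoc, ← mul_pow]
    congr 2; ring
  rw [h1, add_pow, Finset.sum_mul, Polynomial.finsetSum_coeff, Finset.sum_filter, Finset.sum_product]
  refine Finset.sum_congr rfl fun i _ => ?_
  have h2 : (-X ^ 2 : ℤ[X]) ^ i * 1 ^ (d - i) * (d.choose i : ℤ[X]) * (1 + X) ^ (n - 2 * d) =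
      C ((-1 : ℤ) ^ i * (d.choose i)) * (X ^ (2 * i) * (1 + X) ^ (n - 2 * d)) := by
    rw [neg_pow, ← pow_mul]
    simp
    ring
  rw [h2, Polynomial.coeff_C_mul, Polynomial.coeff_X_pow_mul', Polynomial.coeff_one_add_X_pow]
  by_cases hi : i ≤ r
  · rw [if_pos (by omega)]
    by_cases hj : r - i < J + 1
    · rw [Finset.sum_eq_single_of_mem (r - i) (Finset.mem_range.2 hj)]
      · rw [if_pos (by simp; omega), Nat.mul_sub]
      · intro b _ hb
        rw [if_neg]
        simp; omega
    · rw [Nat.choose_eq_zero_of_lt (show n - 2 * d < 2 * r - 2 * i by omega)]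
      rw [Finset.sum_eq_zero]
      · simp
      · intro b hb
        rw [if_neg]
        have := Finset.mem_range.1 hb
        simp; omega
  · rw [if_neg (by omega), mul_zero, Finset.sum_eq_zero]
    intro b hb
    rw [if_neg]
    simp; omega

/-- The abstract form of the result. -/
lemma abstract_main (e : ι → K) (he : Function.Injective e) (ht : ∀ i, tr (e i) = 1) (n d M : ℕ)
    (hn : Fintype.card ι = n) (hd : 2 * d < n) (hK : Fintype.card K = 2 * M)
    (hwt : ∀ b : K, b ≠ 0 → b ≠ 1 → hw (cw e b) = d ∨ hw (cw e b) = n - d) (r J : ℕ)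
    (hJ : n - 2 * d < 2 * J + 2) :
    (∃ lam : ℕ, (∀ p q : ι, p ≠ q →
        #{x : ι → ZMod 2 | (∑ i, x i • e i = 0) ∧ hw x = 2 * r ∧ x p ≠ 0 ∧ x q ≠ 0} = lam) ∧
      lam * (n * (n - 1)) = 2 * r * (2 * r - 1) * #{x : ι → ZMod 2 | (∑ i, x i • e i = 0) ∧ hw x = 2 * r}) ∧
    (M : ℤ) * #{x : ι → ZMod 2 | (∑ i, x i • e i = 0) ∧ hw x = 2 * r} =
      (n.choose (2 * r) : ℤ) + ((M : ℤ) - 1) *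
      ∑ p ∈ (Finset.range (d + 1) ×ˢ Finset.range (J + 1)).filter (fun p => p.1 + p.2 = r),
            (-1 : ℤ) ^ p.1 * (d.choose p.1) * ((n - 2 * d).choose (2 * p.2)) := by
  have h0 : hw (cw e 0) = 0 := by simp [hw, cw]
  have h1 : hw (cw e 1) = n := by
    rw [← hn, hw]
    simp [cw, ht]
  have hKpos : 0 < Fintype.card K := Fintype.card_pos
  constructor
  · obtain ⟨Q, hQ⟩ := const_sum e he ht n d hn hd hwt h0 h1 (fun α β w => (gG n α β w).coeff (2 * r))
    have hlam : ∀ p q : ι, p ≠ q → (Fintype.card K : ℤ) *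
        #{x : ι → ZMod 2 | (∑ i, x i • e i = 0) ∧ hw x = 2 * r ∧ x p ≠ 0 ∧ x q ≠ 0} = Q := by
      intro p q hpq
      rw [dual_count e (fun x => hw x = 2 * r ∧ x p ≠ 0 ∧ x q ≠ 0), ← hQ p q hpq]
      refine Finset.sum_congr rfl fun b _ => ?_
      have := coeff_gp (cw e b) {p, q} (2 * r)
      rw [gp_pair _ p q hpq, hn] at this
      rw [this]
      congr 1
      ext x
      simp
    have : ∃ lam : ℕ, ∀ p q : ι, p ≠ q →
        #{x : ι → ZMod 2 | (∑ i, x i • e i = 0) ∧ hw x = 2 * r ∧ x p ≠ 0 ∧ x q ≠ 0} = lam := by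
      by_cases hex : ∃ p q : ι, p ≠ q
      · obtain ⟨p0, q0, h⟩ := hex
        refine ⟨#{x : ι → ZMod 2 | (∑ i, x i • e i = 0) ∧ hw x = 2 * r ∧ x p0 ≠ 0 ∧ x q0 ≠ 0},
          fun p q hpq => ?_⟩
        have := (hlam p q hpq).trans (hlam p0 q0 h).symm
        have h2 := mul_left_cancel₀ (by exact_mod_cast hKpos.ne') this
        exact_mod_cast h2
      · push Not at hex
        exact ⟨0, fun p q hpq => absurd (hex p q) hpq⟩
    obtain ⟨lam, hl⟩ := this
    refine ⟨lam, hl, ?_⟩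
    rw [← hn]
    apply design_count
    · intro x hx
      exact (Finset.mem_filter.1 hx).2.2
    · intro p q hpq
      rw [← hl p q hpq, Finset.filter_filter]
      congr 1
      ext x
      simp [and_assoc]
  · rw [← coeff_kraw n d r J hd.le hJ]
    have hc := dual_count e (fun x => hw x = 2 * r)
    have hg : ∀ b : K, ∑ x : ι → ZMod 2 with hw x = 2 * r, ∏ i, sg (x i * cw e b i) =
        ((1 - X : ℤ[X]) ^ hw (cw e b) * (1 + X) ^ (n - hw (cw e b))).coeff (2 * r) := by
      intro b
      have := coeff_gp (cw e b) ∅ (2 * r)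
      rw [gp_empty, hn] at this
      rw [this]
      congr 1
      ext x
      simp
    simp_rw [hg] at hc
    rw [← Finset.add_sum_erase _ _ (Finset.mem_univ (0 : K)),
        ← Finset.add_sum_erase (Finset.univ.erase (0 : K)) _ (a := 1) (by simp), h0, h1] at hc
    have hrest : ∑ b ∈ (Finset.univ.erase (0 : K)).erase 1, ((1 - X : ℤ[X]) ^ hw (cw e b) * (1 + X) ^ (n - hw (cw e b))).coeff (2 * r)
        = (2 * (M : ℤ) - 2) * ((1 - X : ℤ[X]) ^ d * (1 + X) ^ (n - d)).coeff (2 * r) := by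
      rw [Finset.sum_congr rfl (g := fun _ => ((1 - X : ℤ[X]) ^ d * (1 + X) ^ (n - d)).coeff (2 * r)),
        Finset.sum_const, Finset.card_erase_of_mem (by simp), Finset.card_erase_of_mem (by simp),
        Finset.card_univ, hK, nsmul_eq_mul]
      · congr 1
        have : 1 ≤ M := by omega
        push_cast [show 1 ≤ 2 * M by omega, show 1 ≤ 2 * M - 1 by omega]
        ring
      · intro b hb
        simp at hb
        rcases hwt b hb.2 hb.1 with h | h
        · rw [h]
        · rw [h, coeff_symm n d r (by omega)]
    have hz : ((1 - X : ℤ[X]) ^ 0 * (1 + X) ^ (n - 0)).coeff (2 * r) = (n.choose (2 * r) : ℤ) := by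
      rw [pow_zero, one_mul, Nat.sub_zero, Polynomial.coeff_one_add_X_pow]
    have hz2 : ((1 - X : ℤ[X]) ^ n * (1 + X) ^ (n - n)).coeff (2 * r) = (n.choose (2 * r) : ℤ) := by
      rw [← hz, ← coeff_symm n 0 r (Nat.zero_le _)]
      simp
    rw [hrest, hz, hz2, hK] at hc
    push_cast at hc
    linarith

end combine
section final
variable {K : Type} [Field K] [Fintype K] [Algebra (ZMod 2) K] [DecidableEq K]

lemma char_sum_D (u : ℕ) (ρ : ZMod 2) (b : K) :
    4 * ∑ x : K with (tr x = 1 ∧ tr (x ^ (2 ^ u + 1)) = ρ), sg (tr (b * x)) =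
      (if b = 0 then (Fintype.card K : ℤ) else 0) - (if b + 1 = 0 then (Fintype.card K : ℤ) else 0)
        + sg ρ * (gS K u b - gS K u (b + 1)) := by
  rw [Finset.sum_filter, Finset.mul_sum, ← sum_sg_tr, ← sum_sg_tr, gS, gS, ← Finset.sum_sub_distrib,
    ← Finset.sum_sub_distrib, Finset.mul_sum, ← Finset.sum_add_distrib]
  refine Finset.sum_congr rfl fun x _ => ?_
  have h : tr (x * (b + 1)) = tr (b * x) + tr x := by
    rw [mul_add, mul_one, mul_comm]; exact map_add _ _ _
  rw [h, mul_comm x b]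
  generalize tr (b * x) = A
  generalize tr x = B
  generalize tr (x ^ (2 ^ u + 1)) = D
  revert A B D ρ
  decide

lemma sg_chi8 {m : ℕ} (hm : Odd m) (ρ : ZMod 2)
    (hρ : (Even ((m ^ 2 - 1) / 8) ∧ ρ = 0) ∨ (Odd ((m ^ 2 - 1) / 8) ∧ ρ = 1)) :
    sg ρ * ZMod.χ₈ m = 1 := by
  rw [ZMod.χ₈_nat_eq_if_mod_eight]
  have h2 : m % 2 = 1 := Nat.odd_iff.1 hm
  have hm8 := Nat.div_add_mod m 8
  set k := m / 8
  have hcase : m % 8 = 1 ∨ m % 8 = 3 ∨ m % 8 = 5 ∨ m % 8 = 7 := by omega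
  have hne : ¬ m % 2 = 0 := by omega
  rw [if_neg hne]
  have key : ∀ j c : ℕ, m % 8 = j → (8 * k + j) ^ 2 = 8 * c + 1 → (m ^ 2 - 1) / 8 = c := by
    intro j c hj hc
    rw [hj] at hm8
    rw [← hm8, hc]
    omega
  rcases hcase with h | h | h | h
  · have := key 1 (2 * (4 * k ^ 2 + k)) h (by ring)
    rw [this] at hρ
    rcases hρ with ⟨_, rfl⟩ | ⟨h', _⟩
    · simp [h, sg_zero]
    · exact absurd h' (by simp)
  · have := key 3 (2 * (4 * k ^ 2 + 3 * k) + 1) h (by ring)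
    rw [this] at hρ
    rcases hρ with ⟨h', _⟩ | ⟨_, rfl⟩
    · exact absurd h' (by simp)
    · simp [h, sg_one]
  · have := key 5 (2 * (4 * k ^ 2 + 5 * k + 1) + 1) h (by ring)
    rw [this] at hρ
    rcases hρ with ⟨h', _⟩ | ⟨_, rfl⟩
    · exact absurd h' (by simp)
    · simp [h, sg_one]
  · have := key 7 (2 * (4 * k ^ 2 + 7 * k + 3)) h (by ring)
    rw [this] at hρ
    rcases hρ with ⟨_, rfl⟩ | ⟨h', _⟩
    · simp [h, sg_zero]
    · exact absurd h' (by simp)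

/-- The numerical facts about the defining set. -/
lemma weights {m u : ℕ} (t : ℕ) (hmt : m = 2 * t + 5) (hgcd : Nat.gcd u m = 1)
    (hK : Fintype.card K = 2 ^ m) (ρ : ZMod 2)
    (hρ : (Even ((m ^ 2 - 1) / 8) ∧ ρ = 0) ∨ (Odd ((m ^ 2 - 1) / 8) ∧ ρ = 1)) :
    (∑ x : K with (tr x = 1 ∧ tr (x ^ (2 ^ u + 1)) = ρ), sg (tr (0 * x)) = 8 * (2 ^ t) ^ 2 - 2 * 2 ^ t) ∧
    ∀ b : K, b ≠ 0 → b ≠ 1 →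
      (∑ x : K with (tr x = 1 ∧ tr (x ^ (2 ^ u + 1)) = ρ), sg (tr (b * x)) = 2 * 2 ^ t ∨
       ∑ x : K with (tr x = 1 ∧ tr (x ^ (2 ^ u + 1)) = ρ), sg (tr (b * x)) = - (2 * 2 ^ t)) := by
  have hm : Odd m := ⟨t + 2, by omega⟩
  have hchar := charTwo K
  have hsq := gS_sq hm hgcd hK
  have ht1 := tr_one hm hK
  have hz : ∀ b : K, tr b = 0 → gS K u b = 0 := by
    intro b hb
    have := hsq b
    rw [if_neg (by rw [hb]; decide)] at this
    exact pow_eq_zero_iff (two_ne_zero) |>.1 this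
  have hs : ∀ b : K, tr b = 1 → gS K u b = 8 * 2 ^ t ∨ gS K u b = - (8 * 2 ^ t) := by
    intro b hb
    have := hsq b
    rw [if_pos hb] at this
    apply sq_eq_sq_iff_eq_or_eq_neg.1
    rw [this, hmt]
    ring
  have hadd : ∀ b : K, tr (b + 1) = tr b + 1 := by
    intro b
    rw [← ht1]; exact map_add _ _ _
  have hsr : sg ρ = 1 ∨ sg ρ = -1 := by
    rcases zmod2_cases ρ with rfl | rfl
    · exact Or.inl rfl
    · exact Or.inr rfl
  constructor
  · have h := char_sum_D u ρ (0 : K)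
    have e0 : gS K u 0 = 0 := hz 0 (by simp)
    have e1 := gS_one m hm K u hgcd hK
    have e2 := sg_chi8 hm ρ hρ
    rw [if_pos rfl, zero_add, if_neg one_ne_zero, e0, e1, hK] at h
    have e3 : (m + 1) / 2 = t + 3 := by omega
    rw [e3] at h
    have e4 : ((2 ^ m : ℕ) : ℤ) = 32 * (2 ^ t) ^ 2 := by
      rw [hmt]; push_cast; ring
    rw [e4] at h
    have e5 : (2 : ℤ) ^ (t + 3) = 8 * 2 ^ t := by ring
    rw [e5] at h
    have e6 : sg ρ * (0 - ZMod.χ₈ (m : ZMod 8) * (8 * 2 ^ t)) = - (8 * 2 ^ t) := by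
      linear_combination (-(8 * 2 ^ t)) * e2
    rw [e6] at h
    linarith
  · intro b hb0 hb1
    have h := char_sum_D u ρ b
    have hb1' : b + 1 ≠ 0 := by
      rwa [Ne, CharTwo.add_eq_zero]
    rw [if_neg hb0, if_neg hb1'] at h
    rcases zmod2_cases (tr b) with hb | hb
    · have h1 : tr (b + 1) = 1 := by rw [hadd, hb]; decide
      rw [hz b hb] at h
      rcases hsr with h3 | h3 <;> rcases hs _ h1 with h2 | h2 <;> rw [h2, h3] at h
      · right; linarith
      · left; linarith
      · left; linarith
      · right; linarith
    · have h1 : tr (b + 1) = 0 := by rw [hadd, hb]; decide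
      rw [hz _ h1] at h
      rcases hsr with h3 | h3 <;> rcases hs _ hb with h2 | h2 <;> rw [h2, h3] at h
      · left; linarith
      · right; linarith
      · right; linarith
      · left; linarith

end final


end helpers

theorem dual_designs_from_codeD_minus (m u : ℕ) (hm : 5 ≤ m) (hmodd : Odd m) (hu : 0 < u)
    (hgcd : Nat.gcd u m = 1) (ρ : ZMod 2)
    (hρ : (Even ((m ^ 2 - 1) / 8) ∧ ρ = 0) ∨ (Odd ((m ^ 2 - 1) / 8) ∧ ρ = 1)) (n d : ℕ)
    (hn : n = 2 ^ (m - 2) - 2 ^ ((m - 3) / 2)) (hd : d = 2 ^ (m - 3) - 2 ^ ((m - 3) / 2)) :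
    ∀ r : ℕ, 2 ≤ r → 2 * r ≤ n - 2 →
      0 < weightCount (dualCode (codeD m u ρ : Set (↥(Dset m u ρ) → ZMod 2))) (2 * r) →
      (∃ lam : ℕ,
        HoldsTwoDesign (dualCode (codeD m u ρ : Set (↥(Dset m u ρ) → ZMod 2))) (2 * r) lam ∧
        lam * (n * (n - 1)) = 2 * r * (2 * r - 1) * weightCount (dualCode (codeD m u ρ : Set (↥(Dset m u ρ) → ZMod 2))) (2 * r)) ∧
      (2 : ℤ) ^ (m - 1) * weightCount (dualCode (codeD m u ρ : Set (↥(Dset m u ρ) → ZMod 2))) (2 * r) =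
        (n.choose (2 * r) : ℤ) + ((2 : ℤ) ^ (m - 1) - 1) *
          ∑ p ∈ (Finset.range (d + 1) ×ˢ Finset.range (2 ^ ((m - 5) / 2) + 1)).filter
              (fun p => p.1 + p.2 = r),
            (-1 : ℤ) ^ p.1 * (d.choose p.1) * ((n - 2 * d).choose (2 * p.2)) := by
  classical
  obtain ⟨t, hmt⟩ : ∃ t, m = 2 * t + 5 := by
    obtain ⟨k, hk⟩ := hmodd
    exact ⟨k - 2, by omega⟩
  intro r _ _ _
  let K := GaloisField 2 m
  letI : Fintype (GaloisField 2 m) := Fintype.ofFinite _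
  letI : Fintype ↥(Dset m u ρ) := Fintype.ofFinite _
  have hK : Fintype.card (GaloisField 2 m) = 2 ^ m := by
    rw [← Nat.card_eq_fintype_card, GaloisField.card 2 m (by omega)]
  have hT : 1 ≤ 2 ^ t := Nat.one_le_two_pow
  have hTT : 2 ^ t ≤ 2 ^ t * 2 ^ t := Nat.le_mul_of_pos_left _ hT
  have hn' : n = 8 * (2 ^ t * 2 ^ t) - 2 * 2 ^ t := by
    rw [hn, hmt]
    have e1 : 2 * t + 5 - 2 = t + t + 3 := by omega
    have e2 : (2 * t + 5 - 3) / 2 = t + 1 := by omega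
    rw [e1, e2, pow_add, pow_add, pow_add]; omega
  have hd' : d = 4 * (2 ^ t * 2 ^ t) - 2 * 2 ^ t := by
    rw [hd, hmt]
    have e1 : 2 * t + 5 - 3 = t + t + 2 := by omega
    have e2 : (2 * t + 5 - 3) / 2 = t + 1 := by omega
    rw [e2, e1, pow_add, pow_add, pow_add]; omega
  have hJ' : (m - 5) / 2 = t := by omega
  let e : ↥(Dset m u ρ) → GaloisField 2 m := Subtype.val
  have hsum : ∀ b : GaloisField 2 m, ∑ i, sg (cw e b i) =
      ∑ x : GaloisField 2 m with (tr x = 1 ∧ tr (x ^ (2 ^ u + 1)) = ρ), sg (tr (b * x)) := by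
    intro b
    symm
    exact Finset.sum_subtype _ (fun x => by simp [Dset]) (fun x => sg (tr (b * x)))
  obtain ⟨w0, w1⟩ := weights (K := GaloisField 2 m) t hmt hgcd hK ρ hρ
  have hcard : Fintype.card ↥(Dset m u ρ) = n := by
    rw [← hsum, sum_v_eq] at w0
    have h0 : hw (cw e 0) = 0 := by simp [hw, cw]
    rw [h0] at w0
    zify at hT hTT
    have : ((Fintype.card ↥(Dset m u ρ) : ℕ) : ℤ) = 8 * (2 ^ t * 2 ^ t) - 2 * 2 ^ t := by
      push_cast at w0; linarith
    rw [hn']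
    zify [show 2 * 2 ^ t ≤ 8 * (2 ^ t * 2 ^ t) by nlinarith]
    exact this
  have hwt : ∀ b : GaloisField 2 m, b ≠ 0 → b ≠ 1 → hw (cw e b) = d ∨ hw (cw e b) = n - d := by
    intro b hb0 hb1
    have h := w1 b hb0 hb1
    rw [← hsum, sum_v_eq, hcard] at h
    have hc : ((2 ^ t : ℕ) : ℤ) = 2 ^ t := by push_cast; rfl
    rw [← hc] at h
    generalize 2 ^ t * 2 ^ t = S at *
    generalize 2 ^ t = T at *
    omega
  have main := abstract_main e Subtype.val_injective (fun i => i.2.1) n d (2 ^ (m - 1)) hcard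
    (by generalize 2 ^ t * 2 ^ t = S at *
        generalize 2 ^ t = T at *
        omega)
    (by rw [hK, ← pow_succ']; congr 1; omega) hwt r (2 ^ ((m - 5) / 2))
    (by rw [hJ']
        generalize 2 ^ t * 2 ^ t = S at *
        generalize 2 ^ t = T at *
        omega)
  have hwteq : ∀ x : ↥(Dset m u ρ) → ZMod 2, wt x = hw x := by
    intro x
    rw [wt, hw, Nat.card_eq_fintype_card, Fintype.card_subtype]
  have hcm : ∀ (b : GaloisField 2 m) i, codeMap m u ρ b i = cw e b i := fun b i => rfl
  have hdual : ∀ x : ↥(Dset m u ρ) → ZMod 2,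
      x ∈ dualCode (codeD m u ρ : Set (↥(Dset m u ρ) → ZMod 2)) ↔ ∑ i, x i • e i = 0 := by
    intro x
    constructor
    · intro hx
      by_contra hne
      obtain ⟨b, hb⟩ := exists_tr _ hne
      have h := hx (codeMap m u ρ b) ⟨b, rfl⟩
      rw [finsum_eq_sum_of_fintype] at h
      simp only [hcm] at h
      rw [inner_eq, mul_comm, hb] at h
      exact one_ne_zero h
    · rintro hx c ⟨b, rfl⟩
      rw [finsum_eq_sum_of_fintype]
      simp only [hcm]
      rw [inner_eq, hx, mul_zero]
      exact map_zero _
  have hcount : weightCount (dualCode (codeD m u ρ : Set (↥(Dset m u ρ) → ZMod 2))) (2 * r) =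
      Finset.card {x : ↥(Dset m u ρ) → ZMod 2 | (∑ i, x i • e i = 0) ∧ hw x = 2 * r} := by
    rw [weightCount, Nat.card_eq_fintype_card, Fintype.card_subtype]
    simp only [hdual, hwteq]
  rw [hcount]
  obtain ⟨⟨lam, hl1, hl2⟩, h3⟩ := main
  refine ⟨⟨lam, ?_, hl2⟩, ?_⟩
  · intro p q hpq
    rw [← hl1 p q hpq, Nat.card_eq_fintype_card, Fintype.card_subtype]
    simp only [hdual, hwteq]
  · push_cast at h3 ⊢
    exact h3
end

section
/- Let m ≥ 5 be odd, let u be a positive integer with gcd(u, m) = 1, and suppose either (m² − 1)/8 is even and ρ = 1, or (m² − 1)/8 is odd and ρ = 0. Set n = 2^{m−2} + 2^{(m−3)/2}. Then the codewords of weight 2^{m−3} in C_{D_ρ} hold a 2-(n, 2^{m−3}, 2^{m−3} − 2^{(m−3)/2}) design, and the codewords of weight w2 = 2^{m−3} + 2^{(m−3)/2} in C_{D_ρ} hold a 2-(n, w2, w2 − 1) design. -/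
open Matrix in
theorem circ_sq {m : ℕ} [NeZero m] (v : ZMod m → ZMod 2) (h : ZMod m) (hh : 2 * h = 1) :
    circulant v * circulant v = circulant (fun i => v (i * h)) := by
  rw [circulant_mul]
  congr 1
  ext i
  simp only [mulVec, dotProduct, circulant_apply]
  rw [← Finset.add_sum_erase _ _ (Finset.mem_univ (i * h))]
  have e1 : i - i * h = i * h := by linear_combination (-i) * hh
  have : ∑ x ∈ Finset.univ.erase (i * h), v (i - x) * v x = 0 := by
    refine Finset.sum_involution (fun j _ => i - j) ?_ ?_ ?_ ?_
    · intro a _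
      rw [sub_sub_cancel, mul_comm (v a)]
      exact CharTwo.add_self_eq_zero _
    · intro a ha _ he
      apply (Finset.mem_erase.1 ha).1
      linear_combination (-a) * hh - h * he
    · intro a ha
      refine Finset.mem_erase.2 ⟨fun he => (Finset.mem_erase.1 ha).1 ?_, Finset.mem_univ _⟩
      linear_combination e1 - he
    · intro a _
      simp
  rw [this, e1, add_zero]
  generalize v (i * h) = z
  revert z; decide

open Matrix in
theorem circ_pow {m : ℕ} [NeZero m] (v : ZMod m → ZMod 2) (h : ZMod m) (hh : 2 * h = 1) (k : ℕ) :
    (circulant v) ^ (2 ^ k) = circulant (fun i => v (i * h ^ k)) := by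
  induction k with
  | zero => simp
  | succ k ih =>
    rw [pow_succ, pow_mul, ih, sq, circ_sq _ h hh]
    congr 1
    ext i
    congr 1
    ring

open Matrix in
theorem circ_pow_circ {m : ℕ} [NeZero m] (v : ZMod m → ZMod 2) (k : ℕ) :
    ∃ s : ZMod m → ZMod 2, (circulant v) ^ k = circulant s := by
  induction k with
  | zero => exact ⟨Pi.single 0 1, by rw [pow_zero, circulant_single_one]⟩
  | succ k ih =>
    obtain ⟨s, hs⟩ := ih
    exact ⟨_, by rw [pow_succ, hs, circulant_mul]⟩

open Matrix in
theorem circ_root {m : ℕ} [NeZero m] (hm : Odd m) (v : ZMod m → ZMod 2)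
    (hs : (circulant v).IsSymm) (hu : IsUnit (circulant v)) :
    ∃ s : ZMod m → ZMod 2, circulant s * circulant v * (circulant s)ᵀ = 1 := by
  have hc : Nat.Coprime 2 m := Nat.coprime_two_left.2 hm
  let w := ZMod.unitOfCoprime 2 hc
  have hh : (2 : ZMod m) * ((w⁻¹ : (ZMod m)ˣ) : ZMod m) = 1 := by
    exact w.mul_inv
  have hk : ((w⁻¹ : (ZMod m)ˣ) : ZMod m) ^ (Nat.totient m) = 1 := by
    rw [← Units.val_pow_eq_pow_val, ZMod.pow_totient, Units.val_one]
  have hpos : 0 < Nat.totient m := Nat.totient_pos.2 (NeZero.pos m)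
  obtain ⟨k, hk'⟩ : ∃ k, Nat.totient m = k + 1 := ⟨_, (Nat.succ_pred_eq_of_pos hpos).symm⟩
  have h1 := circ_pow v _ hh (Nat.totient m)
  simp only [hk, mul_one] at h1
  obtain ⟨s, hs'⟩ := circ_pow_circ v (2 ^ k - 1)
  refine ⟨s, ?_⟩
  rw [← hs', transpose_pow, hs.eq, ← pow_succ, ← pow_add]
  have hp : 0 < 2 ^ k := by positivity
  have e : 2 ^ Nat.totient m = (2 ^ k - 1 + 1 + (2 ^ k - 1)) + 1 := by
    rw [hk', pow_succ]; omega
  rw [e, pow_succ] at h1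
  exact hu.mul_right_cancel (by rw [h1, one_mul])

theorem walk_pow {ι : Type*} [Fintype ι] [DecidableEq ι] (M : Matrix ι ι ℤ) (n : ℕ) (a b : ι) :
    (M ^ (n + 1)) a b = ∑ c : Fin n → ι,
      ∏ i : Fin (n + 1), M ((Fin.cons a c : Fin (n+1) → ι) i) ((Fin.snoc c b : Fin (n+1) → ι) i) := by
  induction n generalizing a with
  | zero => simp [Fin.snoc]
  | succ n ih =>
    rw [pow_succ', Matrix.mul_apply, ← (Fin.consEquiv (fun _ => ι)).sum_comp, Fintype.sum_prod_type]
    refine Finset.sum_congr rfl fun x _ => ?_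
    rw [ih, Finset.mul_sum]
    refine Finset.sum_congr rfl fun c _ => ?_
    rw [Fin.prod_univ_succ (n := n + 1)]
    simp only [Fin.consEquiv, Equiv.coe_fn_mk, Fin.cons_zero, Fin.cons_succ]
    rw [← Fin.cons_snoc_eq_snoc_cons]
    simp

theorem trace_pow_walk {ι : Type*} [Fintype ι] [DecidableEq ι] (M : Matrix ι ι ℤ) (n : ℕ) :
    (M ^ (n + 1)).trace = ∑ c : Fin (n + 1) → ι, ∏ i : Fin (n + 1), M (c i) (c (i + 1)) := by
  rw [Matrix.trace, ← (Fin.consEquiv (fun _ => ι)).sum_comp, Fintype.sum_prod_type]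
  refine Finset.sum_congr rfl fun a _ => ?_
  rw [Matrix.diag_apply, walk_pow]
  refine Finset.sum_congr rfl fun c _ => ?_
  refine Finset.prod_congr rfl fun i _ => ?_
  simp only [Fin.consEquiv, Equiv.coe_fn_mk]
  congr 1
  induction i using Fin.lastCases with
  | last => simp
  | cast i => simp 

/-- Sign character of `ZMod 2`. -/
def sgn (z : ZMod 2) : ℤ := if z = 0 then 1 else -1

theorem sgn_add (a b : ZMod 2) : sgn (a + b) = sgn a * sgn b := by
  revert a b; decide

theorem sgn_sum {ι : Type*} (s : Finset ι) (f : ι → ZMod 2) :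
    sgn (∑ i ∈ s, f i) = ∏ i ∈ s, sgn (f i) := by
  classical
  induction s using Finset.induction_on with
  | empty => simp [sgn]
  | insert a s ha ih => rw [Finset.sum_insert ha, Finset.prod_insert ha, sgn_add, ih]

/-- Transfer matrix. -/
def tmat : Matrix (ZMod 2) (ZMod 2) ℤ := fun a b => sgn (b * a + a)

theorem tmat_sq_sq : tmat ^ 4 = (-4 : ℤ) • (1 : Matrix (ZMod 2) (ZMod 2) ℤ) := by
  decide +kernel

theorem tmat_trace (k : ℕ) : (tmat ^ (2 * k + 1)).trace = (-1) ^ (k * (k + 1) / 2) * 2 ^ (k + 1) := by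
  induction k using Nat.twoStepInduction with
  | zero => decide +kernel
  | one => decide +kernel
  | more k ih _ =>
    have e : 2 * (k + 2) + 1 = 4 + (2 * k + 1) := by ring
    have e2 : (k + 2) * (k + 2 + 1) / 2 = k * (k + 1) / 2 + 2 * (k + 1) + 1 := by
      have : (k + 2) * (k + 2 + 1) = k * (k + 1) + 2 * (2 * (k + 1) + 1) := by ring
      rw [this, Nat.add_mul_div_left _ _ (by norm_num)]; ring
    rw [e, pow_add, tmat_sq_sq, smul_mul_assoc, one_mul, Matrix.trace_smul, ih, e2,
      pow_add (-1 : ℤ) _ 1, pow_add (-1 : ℤ), pow_mul (-1 : ℤ) 2, neg_one_sq, one_pow, smul_eq_mul]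
    ring

theorem sum_walk (m : ℕ) [NeZero m] :
    ∑ c : ZMod m → ZMod 2, sgn (∑ i, (c (i + 1) * c i + c i)) = (tmat ^ m).trace := by
  obtain ⟨n, rfl⟩ : ∃ n, m = n + 1 := ⟨m - 1, by have := NeZero.pos m; omega⟩
  rw [trace_pow_walk]
  simp only [sgn_sum]
  rfl
theorem exists_normal {m : ℕ} [NeZero m] {F : Type*} [Field F] [Algebra (ZMod 2) F]
    [FiniteDimensional (ZMod 2) F] [IsGalois (ZMod 2) F]
    (hF : Module.finrank (ZMod 2) F = m) (σ : Gal(F/ZMod 2)) (hσ : orderOf σ = m) :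
    ∃ b : Module.Basis (ZMod m) (ZMod 2) F, ∀ i, σ (b i) = b (i + 1) := by
  have hpow : ∀ i : ZMod m, σ ^ (i + 1).val = σ * σ ^ i.val := by
    intro i
    rw [ZMod.val_add, ← pow_succ', pow_eq_pow_iff_modEq, hσ]
    refine (Nat.mod_modEq _ _).trans (Nat.ModEq.add_left _ ?_)
    rw [ZMod.val_one_eq_one_mod]
    exact Nat.mod_modEq _ _
  have hinj : Function.Injective (fun i : ZMod m => σ ^ i.val) := by
    intro i j hij
    apply ZMod.val_injective
    exact pow_injOn_Iio_orderOf (by simpa [hσ] using ZMod.val_lt i)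
      (by simpa [hσ] using ZMod.val_lt j) hij
  have hbij : Function.Bijective (fun i : ZMod m => σ ^ i.val) := by
    rw [Fintype.bijective_iff_injective_and_card]
    refine ⟨hinj, ?_⟩
    rw [ZMod.card, ← Nat.card_eq_fintype_card, IsGalois.card_aut_eq_finrank, hF]
  refine ⟨(IsGalois.normalBasis (ZMod 2) F).reindex (Equiv.ofBijective _ hbij).symm, fun i => ?_⟩
  simp only [Module.Basis.reindex_apply, Equiv.symm_symm, Equiv.ofBijective_apply]
  rw [IsGalois.normalBasis_apply, IsGalois.normalBasis_apply (_ ^ (i + 1).val), hpow]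
  rfl

open Matrix in
theorem exists_selfdual {m : ℕ} [NeZero m] (hm : Odd m) {F : Type*} [Field F] [Algebra (ZMod 2) F]
    [FiniteDimensional (ZMod 2) F] [IsGalois (ZMod 2) F]
    (hF : Module.finrank (ZMod 2) F = m) (σ : Gal(F/ZMod 2)) (hσ : orderOf σ = m) :
    ∃ β : ZMod m → F, (∀ i, σ (β i) = β (i + 1)) ∧
      ∀ i j, Algebra.trace (ZMod 2) F (β i * β j) = if i = j then 1 else 0 := by
  obtain ⟨b, hb⟩ := exists_normal hF σ hσ
  have hT : ∀ (k : ℕ) i j, Algebra.trace (ZMod 2) F (b (i + k) * b (j + k)) =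
      Algebra.trace (ZMod 2) F (b i * b j) := by
    intro k i j
    induction k with
    | zero => simp
    | succ k ih =>
      rw [← ih, Nat.cast_succ, ← add_assoc, ← add_assoc, ← hb, ← hb, ← map_mul,
        Algebra.trace_eq_of_algEquiv]
  let v : ZMod m → ZMod 2 := fun k => Algebra.trace (ZMod 2) F (b k * b 0)
  have hA : Algebra.traceMatrix (ZMod 2) b = circulant v := by
    ext i j
    rw [Algebra.traceMatrix_apply, Algebra.traceForm_apply, circulant_apply]
    have := hT j.val (i - j) 0
    simp only [ZMod.natCast_zmod_val, sub_add_cancel, zero_add] at this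
    exact this
  have hsym : (circulant v).IsSymm := by
    rw [← hA]
    ext i j
    simp only [transpose_apply, Algebra.traceMatrix_apply, Algebra.traceForm_apply, mul_comm]
  have hu : IsUnit (circulant v) := by
    rw [isUnit_iff_isUnit_det, ← hA, ← Algebra.discr_def]
    exact Algebra.discr_isUnit_of_basis _ b
  obtain ⟨s, hs⟩ := circ_root hm v hsym hu
  rw [← hA, ← Algebra.traceMatrix_of_matrix_mulVec] at hs
  refine ⟨(circulant s).map (algebraMap (ZMod 2) F) *ᵥ b, ?_, ?_⟩
  · intro i
    simp only [mulVec, dotProduct, map_apply, circulant_apply, map_sum, map_mul,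
      AlgEquiv.commutes, hb]
    refine Fintype.sum_equiv (Equiv.addRight 1) _ _ fun j => ?_
    simp
  · intro i j
    have := congrFun (congrFun hs i) j
    rwa [Algebra.traceMatrix_apply, Algebra.traceForm_apply, one_apply] at this

theorem zmod2_mul_self (z : ZMod 2) : z * z = z := by revert z; decide

theorem sum_sgn {m : ℕ} [NeZero m] (hm : Odd m) {F : Type*} [Field F] [Fintype F]
    [Algebra (ZMod 2) F]
    [FiniteDimensional (ZMod 2) F] [IsGalois (ZMod 2) F]
    (hF : Module.finrank (ZMod 2) F = m) (σ : Gal(F/ZMod 2)) (hσ : orderOf σ = m) :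
    ∑ x : F, sgn (Algebra.trace (ZMod 2) F (x * σ x + x * x)) = (tmat ^ m).trace := by
  obtain ⟨β, hβ, hd⟩ := exists_selfdual hm hF σ hσ
  have hco : ∀ (c : ZMod m → ZMod 2) j,
      Algebra.trace (ZMod 2) F (β j * ∑ i, c i • β i) = c j := by
    intro c j
    rw [Finset.mul_sum, map_sum]
    simp [hd]
  have hinj : Function.Injective (fun c : ZMod m → ZMod 2 => ∑ i, c i • β i) := by
    intro c d h
    ext j
    rw [← hco c j, ← hco d j]
    simp only at h
    rw [h]
  have hbij : Function.Bijective (fun c : ZMod m → ZMod 2 => ∑ i, c i • β i) := by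
    rw [Fintype.bijective_iff_injective_and_card]
    refine ⟨hinj, ?_⟩
    rw [Module.card_eq_pow_finrank (K := ZMod 2) (V := F), hF]
    simp
  rw [← sum_walk, ← hbij.sum_comp]
  refine Finset.sum_congr rfl fun c _ => ?_
  congr 1
  have e1 : ∀ y, Algebra.trace (ZMod 2) F ((∑ i, c i • β i) * y) =
      ∑ i, c i * Algebra.trace (ZMod 2) F (y * β i) := by
    intro y
    rw [Finset.sum_mul, map_sum]
    refine Finset.sum_congr rfl fun i _ => ?_
    rw [smul_mul_assoc, map_smul, smul_eq_mul, mul_comm y]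
  have e2 : σ (∑ i, c i • β i) = ∑ i, c (i - 1) • β i := by
    simp only [map_sum, map_smul, hβ]
    refine Fintype.sum_equiv (Equiv.addRight 1) _ _ fun j => ?_
    simp
  rw [map_add, e1, e1, e2, Finset.sum_add_distrib]
  congr 1
  · refine Fintype.sum_equiv (Equiv.subRight 1) _ _ fun j => ?_
    rw [mul_comm (∑ i, _) (β j), hco]
    simp
  · refine Finset.sum_congr rfl fun i _ => ?_
    rw [mul_comm (∑ i, _) (β i), hco, zmod2_mul_self]
/-- Abstract data of an odd-dimensional quadratic form with radical `{0, e}`. -/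
structure QD (V : Type*) [AddCommGroup V] where
  e : V
  tr : V → ZMod 2
  Q : V → ZMod 2
  B : V → V → ZMod 2
  tr_add : ∀ x y, tr (x + y) = tr x + tr y
  tr_e : tr e = 1
  Q_e : Q e = 1
  Q_add : ∀ x y, Q (x + y) = Q x + Q y + B x y
  B_symm : ∀ x y, B x y = B y x
  B_add : ∀ x y z, B x (y + z) = B x y + B x z
  B_e : ∀ x, B x e = 0
  nondeg : ∀ a, a ≠ 0 → a ≠ e → ∃ y, B a y = 1
  two : ∀ x : V, x + x = 0

theorem sum_neg_shift {V : Type*} [AddCommGroup V] [Fintype V] (g : V → ℤ) (t : V)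
    (h : ∀ x, g (x + t) = - g x) : ∑ x, g x = 0 := by
  have h1 : ∑ x, g (x + t) = ∑ x, g x := Equiv.sum_comp (Equiv.addRight t) g
  simp only [h, Finset.sum_neg_distrib] at h1
  omega

theorem sgn_one : sgn 1 = -1 := by decide
theorem sgn_zero : sgn 0 = 1 := by decide

namespace QD
set_option linter.unusedSectionVars false
variable {V : Type*} [AddCommGroup V] [Fintype V]

/-- The shifted form. -/
def R (d : QD V) (ρ : ZMod 2) (x : V) : ZMod 2 := d.Q x + d.tr x + ρ + 1

theorem B_zero (d : QD V) (x : V) : d.B x 0 = 0 := by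
  have := d.B_add x 0 0
  simpa using this

theorem Q_zero (d : QD V) : d.Q 0 = 0 := by
  have := d.Q_add 0 0
  simpa [d.B_zero] using this

theorem tr_zero (d : QD V) : d.tr 0 = 0 := by
  have := d.tr_add 0 0
  simpa using this

theorem R_e (d : QD V) (ρ : ZMod 2) (x : V) : d.R ρ (x + d.e) = d.R ρ x := by
  simp only [R, d.Q_add, d.tr_add, d.tr_e, d.Q_e, d.B_e]
  generalize d.Q x = a
  generalize d.tr x = b
  revert a b ρ; decide

theorem R_add (d : QD V) (ρ : ZMod 2) (a x : V) :
    d.R ρ (a + x) = d.Q a + (d.B a x + d.tr a) + d.R ρ x := by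
  simp only [R, d.Q_add, d.tr_add]; ring

theorem sum_B (d : QD V) (a : V) (h0 : a ≠ 0) (he : a ≠ d.e) : ∑ x, sgn (d.B a x) = 0 := by
  obtain ⟨y, hy⟩ := d.nondeg a h0 he
  refine sum_neg_shift _ y fun x => ?_
  rw [d.B_add, sgn_add, hy, sgn_one]; ring

theorem weight (d : QD V) (ρ : ZMod 2) (K : ℤ) (hK : ∑ x, sgn (d.R ρ x) = K) (a : V) :
    8 * ((Finset.univ.filter (fun x => (d.tr x = 1 ∧ d.Q x = ρ) ∧ d.B a x + d.tr a ≠ 0)).card : ℤ)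
      = Fintype.card V + K - sgn (d.tr a) * (∑ x, sgn (d.B a x)) - K * sgn (d.Q a) := by
  have key : ∀ t q ρ b : ZMod 2, 8 * (if (t = 1 ∧ q = ρ) ∧ b ≠ 0 then (1 : ℤ) else 0) =
      (1 - sgn t) * (1 + sgn (q + t + ρ + 1)) * (1 - sgn b) := by decide
  rw [Finset.card_filter, Nat.cast_sum, Finset.mul_sum]
  push_cast
  simp only [key]
  have hz : ∑ x, sgn (d.tr x) * ((1 + sgn (d.R ρ x)) * (1 - sgn (d.B a x + d.tr a))) = 0 := by
    refine sum_neg_shift _ d.e fun x => ?_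
    rw [d.R_e, d.tr_add, d.B_add, d.B_e, add_zero, sgn_add, d.tr_e, sgn_one]; ring
  have h4 : ∑ x, sgn (d.R ρ x) * sgn (d.B a x + d.tr a) = K * sgn (d.Q a) := by
    have : ∀ x, sgn (d.R ρ x) * sgn (d.B a x + d.tr a) = sgn (d.R ρ (a + x)) * sgn (d.Q a) := by
      intro x
      rw [R_add, sgn_add (d.Q a + _), sgn_add (d.Q a)]
      have : sgn (d.Q a) * sgn (d.Q a) = 1 := by
        generalize d.Q a = z; revert z; decide
      linear_combination (-sgn (d.B a x + d.tr a) * sgn (d.R ρ x)) * this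
    simp only [this]
    rw [← Finset.sum_mul, ← hK]
    congr 1
    exact Equiv.sum_comp (Equiv.addLeft a) (fun x => sgn (d.R ρ x))
  have e : ∀ x, (1 - sgn (d.tr x)) * (1 + sgn (d.Q x + d.tr x + ρ + 1)) *
      (1 - sgn (d.B a x + d.tr a)) = 1 + sgn (d.R ρ x) - sgn (d.tr a) * sgn (d.B a x)
        - sgn (d.R ρ x) * sgn (d.B a x + d.tr a)
        - sgn (d.tr x) * ((1 + sgn (d.R ρ x)) * (1 - sgn (d.B a x + d.tr a))) := by
    intro x
    rw [sgn_add (d.B a x)]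
    simp only [R]
    ring
  simp only [e, Finset.sum_sub_distrib, Finset.sum_add_distrib, hz, h4, hK, ← Finset.mul_sum]
  simp

theorem pair_sum (d : QD V) (ρ : ZMod 2) (x y : V) (hxy : x ≠ y) (hx : d.tr x = 1)
    (hy : d.tr y = 1) : ∑ a, sgn (d.R ρ (a + x)) * sgn (d.R ρ (a + y)) = 0 := by
  have h1 : ∀ a, sgn (d.R ρ (a + x)) * sgn (d.R ρ (a + y)) =
      sgn (d.B (x + y) a) * (sgn (d.R ρ x) * sgn (d.R ρ y)) := by
    intro a
    rw [R_add, R_add, d.B_symm (x + y), d.B_add]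
    simp only [← sgn_add]
    congr 1
    generalize d.Q a = q
    generalize d.tr a = t
    have : q + q = 0 := CharTwo.add_self_eq_zero q
    have : t + t = 0 := CharTwo.add_self_eq_zero t
    grind
  simp only [h1]
  rw [← Finset.sum_mul, d.sum_B, zero_mul]
  · intro h
    apply hxy
    have := d.two y
    rw [← this] at h
    exact add_right_cancel h
  · intro h
    have := d.tr_add x y
    rw [h, d.tr_e, hx, hy] at this
    exact absurd this (by decide)

theorem shift_sum (d : QD V) (ρ : ZMod 2) (x : V) :
    ∑ a, sgn (d.R ρ (a + x)) = ∑ a, sgn (d.R ρ a) :=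
  Equiv.sum_comp (Equiv.addRight x) (fun a => sgn (d.R ρ a))

theorem R_mem (d : QD V) (ρ : ZMod 2) (x : V) (hx : d.tr x = 1 ∧ d.Q x = ρ) : d.R ρ x = 0 := by
  rw [R, hx.1, hx.2]; clear hx; revert ρ; decide

theorem q_sum (d : QD V) (ρ : ZMod 2) (x y : V) (g : ZMod 2 → ZMod 2 → ℤ) :
    ∑ a, sgn (d.Q a) * g (d.R ρ (a + x)) (d.R ρ (a + y)) = 0 := by
  refine sum_neg_shift _ d.e fun a => ?_
  rw [add_right_comm a d.e x, add_right_comm a d.e y, d.R_e, d.R_e, d.Q_add, d.B_e, d.Q_e, add_zero,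
    sgn_add, sgn_one]
  ring

theorem count0 (d : QD V) (ρ : ZMod 2) (K : ℤ) (hK : ∑ x, sgn (d.R ρ x) = K) (x y : V)
    (hxy : x ≠ y) (hx : d.tr x = 1 ∧ d.Q x = ρ) (hy : d.tr y = 1 ∧ d.Q y = ρ) :
    8 * ((Finset.univ.filter
      (fun a => d.Q a = 0 ∧ d.B a x + d.tr a ≠ 0 ∧ d.B a y + d.tr a ≠ 0)).card : ℤ)
      = Fintype.card V - 2 * K := by
  have key : ∀ q b c : ZMod 2, 8 * (if q = 0 ∧ b ≠ 0 ∧ c ≠ 0 then (1 : ℤ) else 0) =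
      (1 - sgn (q + b)) * (1 - sgn (q + c))
       + sgn q * ((1 - sgn (q + b)) * (1 - sgn (q + c))) := by decide
  rw [Finset.card_filter, Nat.cast_sum, Finset.mul_sum]
  push_cast
  simp only [key]
  have hR : ∀ z, (d.tr z = 1 ∧ d.Q z = ρ) → ∀ a, d.Q a + (d.B a z + d.tr a) = d.R ρ (a + z) := by
    intro z hz a
    rw [R_add, d.R_mem ρ z hz, add_zero]
  simp only [hR x hx, hR y hy]
  rw [Finset.sum_add_distrib, d.q_sum ρ x y (fun b c => (1 - sgn b) * (1 - sgn c)), add_zero]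
  have e : ∀ a, (1 - sgn (d.R ρ (a + x))) * (1 - sgn (d.R ρ (a + y))) =
    1 - sgn (d.R ρ (a + x)) - sgn (d.R ρ (a + y)) + sgn (d.R ρ (a + x)) * sgn (d.R ρ (a + y)) := by
    intro a; ring
  simp only [e, Finset.sum_sub_distrib, Finset.sum_add_distrib, d.pair_sum ρ x y hxy hx.1 hy.1,
    d.shift_sum, hK]
  simp
  ring

theorem count1 (d : QD V) (ρ : ZMod 2) (K : ℤ) (hK : ∑ x, sgn (d.R ρ x) = K) (x y : V)
    (hxy : x ≠ y) (hx : d.tr x = 1 ∧ d.Q x = ρ) (hy : d.tr y = 1 ∧ d.Q y = ρ) :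
    8 * ((Finset.univ.filter
      (fun a => d.Q a = 1 ∧ d.B a x + d.tr a ≠ 0 ∧ d.B a y + d.tr a ≠ 0)).card : ℤ)
      = Fintype.card V + 2 * K := by
  have key : ∀ q b c : ZMod 2, 8 * (if q = 1 ∧ b ≠ 0 ∧ c ≠ 0 then (1 : ℤ) else 0) =
      (1 + sgn (q + b)) * (1 + sgn (q + c))
       - sgn q * ((1 + sgn (q + b)) * (1 + sgn (q + c))) := by decide
  rw [Finset.card_filter, Nat.cast_sum, Finset.mul_sum]
  push_cast
  simp only [key]
  have hR : ∀ z, (d.tr z = 1 ∧ d.Q z = ρ) → ∀ a, d.Q a + (d.B a z + d.tr a) = d.R ρ (a + z) := by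
    intro z hz a
    rw [R_add, d.R_mem ρ z hz, add_zero]
  simp only [hR x hx, hR y hy]
  rw [Finset.sum_sub_distrib, d.q_sum ρ x y (fun b c => (1 + sgn b) * (1 + sgn c)), sub_zero]
  have e : ∀ a, (1 + sgn (d.R ρ (a + x))) * (1 + sgn (d.R ρ (a + y))) =
    1 + sgn (d.R ρ (a + x)) + sgn (d.R ρ (a + y)) + sgn (d.R ρ (a + x)) * sgn (d.R ρ (a + y)) := by
    intro a; ring
  simp only [e, Finset.sum_add_distrib, d.pair_sum ρ x y hxy hx.1 hy.1,
    d.shift_sum, hK]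
  simp
  ring

/-- weight of the codeword attached to `a` -/
noncomputable def W (d : QD V) (ρ : ZMod 2) (a : V) : ℕ :=
  (Finset.univ.filter (fun x => (d.tr x = 1 ∧ d.Q x = ρ) ∧ d.B a x + d.tr a ≠ 0)).card

theorem W_spec (d : QD V) (ρ : ZMod 2) (P p : ℕ) (hV : Fintype.card V = 8 * P)
    (hK : ∑ x, sgn (d.R ρ x) = 4 * p) (a : V) :
    (a = 0 → d.W ρ a = 0) ∧ (a = d.e → d.W ρ a = 2 * P + p) ∧
    (a ≠ 0 → a ≠ d.e → d.Q a = 0 → d.W ρ a = P) ∧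
    (a ≠ 0 → a ≠ d.e → d.Q a = 1 → d.W ρ a = P + p) := by
  have h := d.weight ρ _ hK a
  rw [hV] at h
  change 8 * (d.W ρ a : ℤ) = _ at h
  push_cast at h
  refine ⟨?_, ?_, ?_, ?_⟩
  · rintro rfl
    have : ∑ x, sgn (d.B 0 x) = 8 * P := by
      simp only [d.B_symm 0, d.B_zero, sgn_zero]
      simp [hV]
    rw [this, d.tr_zero, d.Q_zero, sgn_zero] at h
    omega
  · rintro rfl
    have : ∑ x, sgn (d.B d.e x) = 8 * P := by
      simp only [d.B_symm d.e, d.B_e, sgn_zero]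
      simp [hV]
    rw [this, d.tr_e, d.Q_e, sgn_one] at h
    omega
  · intro h0 he hq
    rw [d.sum_B a h0 he, hq, sgn_zero] at h
    omega
  · intro h0 he hq
    rw [d.sum_B a h0 he, hq, sgn_one] at h
    omega

theorem W_eq_iff (d : QD V) (ρ : ZMod 2) (P p : ℕ) (hV : Fintype.card V = 8 * P)
    (hK : ∑ x, sgn (d.R ρ x) = 4 * p) (hP : 0 < P) (hp : 0 < p) (a : V) :
    (d.W ρ a = P ↔ a ≠ 0 ∧ a ≠ d.e ∧ d.Q a = 0) ∧
    (d.W ρ a = P + p ↔ a ≠ 0 ∧ a ≠ d.e ∧ d.Q a = 1) ∧ (d.W ρ a = 0 ↔ a = 0) := by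
  obtain ⟨h1, h2, h3, h4⟩ := d.W_spec ρ P p hV hK a
  by_cases h0 : a = 0
  · have := h1 h0
    simp only [h0, ne_eq, not_true_eq_false, false_and, iff_false, iff_true]
    rw [h0] at this
    omega
  by_cases he : a = d.e
  · have := h2 he
    simp only [he, ne_eq, not_true_eq_false, false_and, and_false, iff_false]
    rw [← he]
    refine ⟨by omega, by omega, ?_⟩
    simp only [h0, iff_false]
    omega
  have hq : d.Q a = 0 ∨ d.Q a = 1 := by
    generalize d.Q a = z; revert z; decide
  rcases hq with hq | hq
  · have := h3 h0 he hq
    simp [h0, he, hq, this]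
    omega
  · have := h4 h0 he hq
    simp [h0, he, hq, this]
    omega

theorem final0 (d : QD V) (ρ : ZMod 2) (P p : ℕ) (hV : Fintype.card V = 8 * P)
    (hK : ∑ x, sgn (d.R ρ x) = 4 * p) (hP : 0 < P) (hp : 0 < p) (x y : V)
    (hxy : x ≠ y) (hx : d.tr x = 1 ∧ d.Q x = ρ) (hy : d.tr y = 1 ∧ d.Q y = ρ) :
    Nat.card {a // d.W ρ a = P ∧ d.B a x + d.tr a ≠ 0 ∧ d.B a y + d.tr a ≠ 0} = P - p := by
  have h := d.count0 ρ _ hK x y hxy hx hy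
  classical
  rw [Nat.card_eq_fintype_card, Fintype.card_subtype]
  have : (Finset.univ.filter
      (fun a => d.W ρ a = P ∧ d.B a x + d.tr a ≠ 0 ∧ d.B a y + d.tr a ≠ 0)) =
      (Finset.univ.filter
      (fun a => d.Q a = 0 ∧ d.B a x + d.tr a ≠ 0 ∧ d.B a y + d.tr a ≠ 0)) := by
    ext a
    simp only [Finset.mem_filter, Finset.mem_univ, true_and,
      (d.W_eq_iff ρ P p hV hK hP hp a).1]
    constructor
    · rintro ⟨h1, h2⟩
      exact ⟨h1.2.2, h2⟩
    · rintro ⟨h1, h2⟩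
      refine ⟨⟨?_, ?_, h1⟩, h2⟩
      · rintro rfl
        apply h2.1
        rw [d.B_symm, d.B_zero, d.tr_zero, add_zero]
      · rintro rfl
        rw [d.Q_e] at h1
        exact absurd h1 (by decide)
  rw [this]
  omega

theorem final1 (d : QD V) (ρ : ZMod 2) (P p : ℕ) (hV : Fintype.card V = 8 * P)
    (hK : ∑ x, sgn (d.R ρ x) = 4 * p) (hP : 0 < P) (hp : 0 < p) (x y : V)
    (hxy : x ≠ y) (hx : d.tr x = 1 ∧ d.Q x = ρ) (hy : d.tr y = 1 ∧ d.Q y = ρ) :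
    Nat.card {a // d.W ρ a = P + p ∧ d.B a x + d.tr a ≠ 0 ∧ d.B a y + d.tr a ≠ 0}
      = P + p - 1 := by
  have h := d.count1 ρ _ hK x y hxy hx hy
  classical
  rw [Nat.card_eq_fintype_card, Fintype.card_subtype]
  have : (Finset.univ.filter
      (fun a => d.W ρ a = P + p ∧ d.B a x + d.tr a ≠ 0 ∧ d.B a y + d.tr a ≠ 0)) =
      (Finset.univ.filter
      (fun a => d.Q a = 1 ∧ d.B a x + d.tr a ≠ 0 ∧ d.B a y + d.tr a ≠ 0)).erase d.e := by
    ext a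
    simp only [Finset.mem_erase, Finset.mem_filter, Finset.mem_univ, true_and,
      (d.W_eq_iff ρ P p hV hK hP hp a).2.1]
    constructor
    · rintro ⟨h1, h2⟩
      exact ⟨h1.2.1, h1.2.2, h2⟩
    · rintro ⟨h0, h1, h2⟩
      refine ⟨⟨?_, h0, h1⟩, h2⟩
      rintro rfl
      rw [d.Q_zero] at h1
      exact absurd h1 (by decide)
  rw [this, Finset.card_erase_of_mem]
  · omega
  · simp [d.Q_e, d.B_symm d.e, d.B_e, d.tr_e]

end QD
theorem fixed_of_s12 {m : ℕ} (hm : Odd m) {F : Type*} [Field F] [Algebra (ZMod 2) F]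
    [FiniteDimensional (ZMod 2) F] [IsGalois (ZMod 2) F]
    (hF : Module.finrank (ZMod 2) F = m) (σ : Gal(F/ZMod 2)) (hσ : orderOf σ = m) (a : F)
    (ha : σ (σ a) = a) : a = 0 ∨ a = 1 := by
  have ho : orderOf (σ ^ 2) = m := by
    rw [Nat.Coprime.orderOf_pow, hσ]
    rw [hσ]; exact Nat.coprime_two_right.2 hm
  have htop : Subgroup.zpowers (σ ^ 2) = ⊤ := by
    apply Subgroup.eq_top_of_card_eq
    rw [Nat.card_zpowers, ho, IsGalois.card_aut_eq_finrank, hF]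
  have hall : ∀ g : Gal(F/ZMod 2), g a = a := by
    intro g
    have hg : g ∈ Subgroup.zpowers (σ ^ 2) := htop ▸ Subgroup.mem_top g
    have hle : Subgroup.zpowers (σ ^ 2) ≤ MulAction.stabilizer Gal(F/ZMod 2) a := by
      rw [Subgroup.zpowers_le, MulAction.mem_stabilizer_iff, sq]
      exact ha
    exact hle hg
  obtain ⟨z, rfl⟩ := (IsGalois.mem_range_algebraMap_iff_fixed a).2 hall
  have : z = 0 ∨ z = 1 := by clear ha hall; revert z; decide
  rcases this with rfl | rfl
  · left; simp
  · right; simp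

theorem rad_nondeg {m : ℕ} (hm : Odd m) {F : Type*} [Field F] [Algebra (ZMod 2) F]
    [FiniteDimensional (ZMod 2) F] [IsGalois (ZMod 2) F]
    (hF : Module.finrank (ZMod 2) F = m) (σ : Gal(F/ZMod 2)) (hσ : orderOf σ = m) (a : F)
    (ha : σ a + σ.symm a = 0) : a = 0 ∨ a = 1 := by
  have : CharP F 2 := charP_of_injective_algebraMap (algebraMap (ZMod 2) F).injective 2
  refine fixed_of_s12 hm hF σ hσ a ?_
  rw [CharTwo.add_eq_zero] at ha
  rw [ha, AlgEquiv.apply_symm_apply]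

theorem tr_B {F : Type*} [Field F] [Algebra (ZMod 2) F] (σ : Gal(F/ZMod 2)) (a x : F) :
    Algebra.trace (ZMod 2) F ((σ a + σ.symm a) * x) =
      Algebra.trace (ZMod 2) F (σ a * x + a * σ x) := by
  have : Algebra.trace (ZMod 2) F (σ.symm a * x) = Algebra.trace (ZMod 2) F (a * σ x) := by
    rw [← Algebra.trace_eq_of_algEquiv σ, map_mul, AlgEquiv.apply_symm_apply]
  rw [add_mul, map_add, map_add, this]

/-- The quadratic form data of the field. -/
noncomputable def fieldQD {m : ℕ} (hm : Odd m) {F : Type*} [Field F] [Algebra (ZMod 2) F]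
    [FiniteDimensional (ZMod 2) F] [IsGalois (ZMod 2) F]
    (hF : Module.finrank (ZMod 2) F = m) (σ : Gal(F/ZMod 2)) (hσ : orderOf σ = m) : QD F where
  e := 1
  tr := fun x => Algebra.trace (ZMod 2) F x
  Q := fun x => Algebra.trace (ZMod 2) F (x * σ x)
  B := fun x y => Algebra.trace (ZMod 2) F (σ x * y + x * σ y)
  tr_add := fun x y => map_add _ x y
  tr_e := by
    have := Algebra.trace_algebraMap (S := F) (1 : ZMod 2)
    rw [map_one, hF, nsmul_eq_mul, mul_one] at this
    rw [this]
    exact ZMod.natCast_eq_one_iff_odd.2 hm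
  Q_e := by
    have := Algebra.trace_algebraMap (S := F) (1 : ZMod 2)
    rw [map_one, hF, nsmul_eq_mul, mul_one] at this
    rw [map_one, mul_one, this]
    exact ZMod.natCast_eq_one_iff_odd.2 hm
  Q_add := fun x y => by
    rw [← map_add, ← map_add, map_add]
    congr 1; ring
  B_symm := fun x y => by congr 1; ring
  B_add := fun x y z => by
    rw [← map_add, map_add σ]
    congr 1; ring
  B_e := fun x => by
    rw [map_one, mul_one, mul_one, map_add, Algebra.trace_eq_of_algEquiv]
    exact CharTwo.add_self_eq_zero _
  nondeg := fun a h0 h1 => by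
    by_contra! hc
    have h2 : ∀ y, Algebra.trace (ZMod 2) F ((σ a + σ.symm a) * y) = 0 := by
      intro y
      rw [tr_B]
      have := hc y
      revert this
      generalize Algebra.trace (ZMod 2) F (σ a * y + a * σ y) = z
      revert z; decide
    have h3 := (traceForm_nondegenerate (ZMod 2) F).1 (σ a + σ.symm a) h2
    rcases rad_nondeg hm hF σ hσ a h3 with h | h
    · exact h0 h
    · exact h1 h
  two := fun x => by
    have : CharP F 2 := charP_of_injective_algebraMap (algebraMap (ZMod 2) F).injective 2
    exact CharTwo.add_self_eq_zero x

theorem tr_sq_s12 {F : Type*} [Field F] [Finite F] [Algebra (ZMod 2) F] (x : F) :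
    Algebra.trace (ZMod 2) F (x * x) = Algebra.trace (ZMod 2) F x := by
  have := Algebra.trace_eq_of_algEquiv (FiniteField.frobeniusAlgEquivOfAlgebraic (ZMod 2) F) x
  rw [← this]
  congr 1
  rw [FiniteField.coe_frobeniusAlgEquivOfAlgebraic]
  simp [sq]

theorem designs_from_codeD_plus (m u : ℕ) (hm : 5 ≤ m) (hmodd : Odd m) (hu : 0 < u)
    (hgcd : Nat.gcd u m = 1) (ρ : ZMod 2)
    (hρ : (Even ((m ^ 2 - 1) / 8) ∧ ρ = 1) ∨ (Odd ((m ^ 2 - 1) / 8) ∧ ρ = 0)) (n : ℕ) (hn : n = 2 ^ (m - 2) + 2 ^ ((m - 3) / 2)) :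
    HoldsTwoDesign (codeD m u ρ : Set (↥(Dset m u ρ) → ZMod 2)) (2 ^ (m - 3)) (2 ^ (m - 3) - 2 ^ ((m - 3) / 2)) ∧
    HoldsTwoDesign (codeD m u ρ : Set (↥(Dset m u ρ) → ZMod 2)) (2 ^ (m - 3) + 2 ^ ((m - 3) / 2))
      (2 ^ (m - 3) + 2 ^ ((m - 3) / 2) - 1) := by
  classical
  have : NeZero m := ⟨by omega⟩
  let : Fintype (GaloisField 2 m) := Fintype.ofFinite _
  have hF : Module.finrank (ZMod 2) (GaloisField 2 m) = m := GaloisField.finrank 2 (by omega)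
  let σ : Gal(GaloisField 2 m/ZMod 2) :=
    (FiniteField.frobeniusAlgEquivOfAlgebraic (ZMod 2) (GaloisField 2 m)) ^ u
  have hσ : orderOf σ = m := by
    have h1 := FiniteField.orderOf_frobeniusAlgEquivOfAlgebraic (ZMod 2) (GaloisField 2 m)
    rw [hF] at h1
    rw [Nat.Coprime.orderOf_pow, h1]
    rw [h1]; exact Nat.Coprime.symm hgcd
  have hσx : ∀ x, σ x = x ^ (2 ^ u) := by
    intro x
    simp only [σ, AlgEquiv.coe_pow, FiniteField.coe_frobeniusAlgEquivOfAlgebraic_iterate]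
    simp
  let d := fieldQD hmodd hF σ hσ
  have hD : ∀ x, x ∈ Dset m u ρ ↔ (d.tr x = 1 ∧ d.Q x = ρ) := by
    intro x
    change _ ↔ (_ ∧ Algebra.trace (ZMod 2) (GaloisField 2 m) (x * σ x) = ρ)
    rw [hσx, ← pow_succ']
    rfl
  -- the sum
  obtain ⟨k, rfl⟩ : ∃ k, m = 2 * k + 3 := by
    obtain ⟨j, hj⟩ := hmodd
    exact ⟨j - 1, by omega⟩
  have hsum := sum_sgn hmodd hF σ hσ
  have htm := tmat_trace (k + 1)
  rw [show 2 * (k + 1) + 1 = 2 * k + 3 by ring] at htm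
  rw [htm] at hsum
  have hidx : ((2 * k + 3) ^ 2 - 1) / 8 = (k + 1) * (k + 1 + 1) / 2 := by
    have : (2 * k + 3) ^ 2 - 1 = 4 * ((k + 1) * (k + 1 + 1)) := by
      have : (2 * k + 3) ^ 2 = 4 * ((k + 1) * (k + 1 + 1)) + 1 := by ring
      omega
    rw [this]
    omega
  rw [hidx] at hρ
  have e1 : 2 * k + 3 - 3 = 2 * k := by omega
  have e2 : 2 * k / 2 = k := by omega
  rw [e1, e2]
  have hK : ∑ x, sgn (d.R ρ x) = 4 * ((2 ^ k : ℕ) : ℤ) := by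
    have h1 : ∀ x, sgn (d.R ρ x) =
        sgn (Algebra.trace (ZMod 2) (GaloisField 2 (2 * k + 3)) (x * σ x + x * x)) *
          sgn (ρ + 1) := by
      intro x
      rw [← sgn_add, map_add, tr_sq_s12, ← add_assoc]
      rfl
    simp only [h1]
    rw [← Finset.sum_mul, hsum]
    rcases hρ with ⟨h, rfl⟩ | ⟨h, rfl⟩
    · rw [h.neg_one_pow, show sgn (1 + 1) = 1 by decide]; push_cast; ring
    · rw [h.neg_one_pow, show sgn (0 + 1) = -1 by decide]; push_cast; ring
  have hV : Fintype.card (GaloisField 2 (2 * k + 3)) = 8 * 2 ^ (2 * k) := by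
    rw [← Nat.card_eq_fintype_card, GaloisField.card 2 _ (by omega)]
    ring
  have hP : 0 < 2 ^ (2 * k) := by positivity
  have hp : 0 < 2 ^ k := by positivity
  -- parametrisation of the code
  let ψ : GaloisField 2 (2 * k + 3) → GaloisField 2 (2 * k + 3) :=
    fun a => σ a + σ.symm a + algebraMap (ZMod 2) _ (d.tr a)
  have hcode : ∀ a (x : Dset (2 * k + 3) u ρ), codeMap _ u ρ (ψ a) x = d.B a x + d.tr a := by
    intro a x
    change Algebra.trace (ZMod 2) _ (ψ a * x) = _
    have hx : Algebra.trace (ZMod 2) _ (x : GaloisField 2 (2 * k + 3)) = 1 := x.2.1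
    simp only [ψ]
    rw [add_mul, map_add, tr_B, ← Algebra.smul_def, map_smul, hx, smul_eq_mul, mul_one]
    rfl
  have hψadd : ∀ a b, ψ (a + b) = ψ a + ψ b := by
    intro a b
    simp only [ψ, d.tr_add, map_add]
    ring
  have hwt : ∀ a, wt (codeMap _ u ρ (ψ a)) = d.W ρ a := by
    intro a
    rw [wt, QD.W, ← Fintype.card_subtype, ← Nat.card_eq_fintype_card]
    simp only [hcode]
    refine Nat.card_congr ?_
    refine (Equiv.subtypeSubtypeEquivSubtypeInter (fun x => x ∈ Dset (2 * k + 3) u ρ)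
      (fun x => d.B a x + d.tr a ≠ 0)).trans (Equiv.subtypeEquivRight fun x => ?_)
    rw [hD]
  have hW := d.W_eq_iff ρ _ _ hV hK hP hp
  have hinj : Function.Injective (fun a => codeMap (2 * k + 3) u ρ (ψ a)) := by
    intro a b hab
    have h0 : codeMap _ u ρ (ψ (a + b)) = 0 := by
      rw [hψadd, map_add]
      simp only at hab
      rw [hab]
      ext x
      exact CharTwo.add_self_eq_zero _
    have h1 := hwt (a + b)
    rw [h0] at h1
    have h2 : wt (0 : Dset (2 * k + 3) u ρ → ZMod 2) = 0 := by simp [wt]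
    have h3 := (hW (a + b)).2.2.1 (by rw [← h1, h2])
    rw [← d.two b] at h3
    exact add_right_cancel h3
  have hψinj : Function.Injective ψ := by
    intro a b hab
    exact hinj (by simp only [hab])
  have hψsurj : Function.Surjective ψ := Finite.surjective_of_injective hψinj
  have hcard : ∀ (w : ℕ) (p q : Dset (2 * k + 3) u ρ),
      Nat.card {c : Dset (2 * k + 3) u ρ → ZMod 2 //
        c ∈ (codeD (2 * k + 3) u ρ : Set (Dset (2 * k + 3) u ρ → ZMod 2)) ∧
          wt c = w ∧ c p ≠ 0 ∧ c q ≠ 0} =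
      Nat.card {a // d.W ρ a = w ∧ d.B a p + d.tr a ≠ 0 ∧ d.B a q + d.tr a ≠ 0} := by
    intro w p q
    symm
    refine Nat.card_eq_of_bijective (fun a => ⟨codeMap _ u ρ (ψ a.1), ⟨_, rfl⟩, ?_⟩) ⟨?_, ?_⟩
    · rw [hwt, hcode, hcode]; exact a.2
    · intro a b hab
      exact Subtype.ext (hinj (congrArg Subtype.val hab))
    · rintro ⟨c, ⟨b, rfl⟩, hc⟩
      obtain ⟨a, rfl⟩ := hψsurj b
      rw [hwt, hcode, hcode] at hc
      exact ⟨⟨a, hc⟩, rfl⟩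
  constructor
  · intro p q hpq
    rw [hcard]
    exact d.final0 ρ _ _ hV hK hP hp p q (fun h => hpq (Subtype.ext h)) ((hD _).1 p.2)
      ((hD _).1 q.2)
  · intro p q hpq
    rw [hcard]
    exact d.final1 ρ _ _ hV hK hP hp p q (fun h => hpq (Subtype.ext h)) ((hD _).1 p.2)
      ((hD _).1 q.2)
end

section
/- Let m ≥ 5 be odd and let u be a positive integer with gcd(u, m) = 1. Then |D_0| = 2^{m−2} − ε·2^{(m−3)/2} and |D_1| = 2^{m−2} + ε·2^{(m−3)/2}, where ε = (−1)^{(m²−1)/8} (i.e., ε = 1 if (m² − 1)/8 is even and ε = −1 if (m² − 1)/8 is odd). -/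
namespace GoldSum

/-- The nontrivial sign character on `ZMod 2`. -/
def sgn (t : ZMod 2) : ℤ := if t = 0 then 1 else -1

lemma sgn_add (a b : ZMod 2) : sgn (a + b) = sgn a * sgn b := by
  revert a b; decide

lemma sgn_zero : sgn 0 = 1 := rfl

lemma sgn_one : sgn 1 = -1 := rfl

variable {K : Type} [Field K] [Fintype K] [Algebra (ZMod 2) K]

lemma charTwo : CharP K 2 := charP_of_injective_algebraMap' (ZMod 2) 2

/-- absolute trace -/
noncomputable abbrev tr (x : K) : ZMod 2 := Algebra.trace (ZMod 2) K x

lemma tr_sq (x : K) : tr (x ^ 2) = tr x := by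
  have h := Algebra.trace_eq_of_algEquiv (FiniteField.frobeniusAlgEquivOfAlgebraic (ZMod 2) K) x
  simpa [ZMod.card] using h

lemma tr_pow (x : K) (k : ℕ) : tr (x ^ 2 ^ k) = tr x := by
  induction k with
  | zero => simp
  | succ k ih => rw [pow_succ, pow_mul, tr_sq, ih]

lemma sum_sgn_linear (L : K →+ ZMod 2) (h : ∃ a, L a ≠ 0) : ∑ x, sgn (L x) = 0 := by
  obtain ⟨a, ha⟩ := h
  have h1 : ∑ x, sgn (L x) = ∑ x, sgn (L (x + a)) :=
    (Equiv.sum_comp (Equiv.addRight a) (fun x => sgn (L x))).symm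
  have h2 : sgn (L a) = -1 := by
    simp [sgn, ha]
  simp_rw [map_add, sgn_add, h2] at h1
  rw [← Finset.sum_mul] at h1
  linarith

/-- The quadratic form. -/
noncomputable def Q (u : ℕ) (c x : K) : ZMod 2 := tr (x ^ (2 ^ u + 1) + c * x)

lemma add_pow_two_pow (x y : K) (u : ℕ) : (x + y) ^ 2 ^ u = x ^ 2 ^ u + y ^ 2 ^ u := by
  have : CharP K 2 := charTwo
  exact add_pow_char_pow x y 2 u

lemma z2 (a : ZMod 2) : a + a = 0 := by revert a; decide

lemma Q_add (u : ℕ) (c x h : K) :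
    Q u c x + Q u c (x + h) = Q u c h + tr (x ^ 2 ^ u * (h + h ^ 2 ^ (2 * u))) := by
  have e : (x + h) ^ (2 ^ u + 1) + c * (x + h) =
      (x ^ (2 ^ u + 1) + c * x) + (h ^ (2 ^ u + 1) + c * h) +
        (x ^ 2 ^ u * h + x * h ^ 2 ^ u) := by
    rw [pow_succ, add_pow_two_pow]; ring
  have e2 : tr (x ^ 2 ^ u * h ^ 2 ^ (2 * u)) = tr (x * h ^ 2 ^ u) := by
    rw [two_mul, pow_add, pow_mul, ← mul_pow, tr_pow]
  unfold Q
  rw [e, mul_add]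
  simp only [tr, map_add] at e2 ⊢
  rw [e2]
  linear_combination z2 (Algebra.trace (ZMod 2) K (x ^ (2 ^ u + 1))) +
    z2 (Algebra.trace (ZMod 2) K (c * x))

lemma fix_of (m u : ℕ) (hK : Fintype.card K = 2 ^ m) (hg : Nat.gcd (2 * u) m = 1) (h : K)
    (hh : h ^ 2 ^ (2 * u) = h) : h = 0 ∨ h = 1 := by
  have it : ∀ k, (fun x : K => x ^ 2)^[k] h = h ^ 2 ^ k := by
    intro k
    induction k with
    | zero => simp
    | succ k ih => rw [Function.iterate_succ_apply', ih, ← pow_mul, ← pow_succ]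
  have p1 : Function.IsPeriodicPt (fun x : K => x ^ 2) (2 * u) h := by
    rw [Function.IsPeriodicPt, Function.IsFixedPt, it, hh]
  have p2 : Function.IsPeriodicPt (fun x : K => x ^ 2) m h := by
    rw [Function.IsPeriodicPt, Function.IsFixedPt, it, ← hK, FiniteField.pow_card]
  have p3 := p1.gcd p2
  rw [hg, Function.IsPeriodicPt, Function.IsFixedPt, it] at p3
  have : h * (h - 1) = 0 := by linear_combination p3
  rcases mul_eq_zero.mp this with h0 | h0
  · exact Or.inl h0
  · exact Or.inr (sub_eq_zero.mp h0)

/-- The exponential sum. -/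
noncomputable def S (K : Type) [Field K] [Fintype K] [Algebra (ZMod 2) K] (u : ℕ) (c : K) : ℤ :=
  ∑ x : K, sgn (Q u c x)

lemma inner_zero (u : ℕ) (b : K) (hb : b ≠ 0) :
    ∑ x : K, sgn (tr (x ^ 2 ^ u * b)) = 0 := by
  let L : K →+ ZMod 2 :=
    { toFun := fun x => tr (x ^ 2 ^ u * b)
      map_zero' := by simp [tr]
      map_add' := fun x y => by rw [add_pow_two_pow, add_mul]; simp [tr] }
  refine sum_sgn_linear L ?_
  by_contra! hL
  have hsurj : Function.Surjective (fun x : K => x ^ 2 ^ u) := by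
    apply Finite.injective_iff_surjective.mp
    have : CharP K 2 := charTwo
    exact iterateFrobenius_inj K 2 u
  apply hb
  apply (traceForm_nondegenerate (ZMod 2) K).1 b
  intro y
  obtain ⟨x, rfl⟩ := hsurj y
  rw [Algebra.traceForm_apply, mul_comm]
  exact hL x

lemma S_sq (m u : ℕ) (hK : Fintype.card K = 2 ^ m) (hg : Nat.gcd (2 * u) m = 1) (c : K) :
    S K u c ^ 2 = 2 ^ m * (1 + sgn (tr (1 + c))) := by
  have : CharP K 2 := charTwo
  classical
  have h1 : S K u c ^ 2 = ∑ h : K, ∑ x : K, sgn (Q u c x + Q u c (x + h)) := by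
    rw [sq, S, Finset.sum_mul_sum]
    rw [Finset.sum_comm (f := fun h x : K => sgn (Q u c x + Q u c (x + h)))]
    refine Finset.sum_congr rfl fun x _ => ?_
    rw [← Equiv.sum_comp (Equiv.addLeft x)]
    simp [sgn_add]
  have h2 : ∀ h : K, h ≠ 0 → h ≠ 1 → ∑ x : K, sgn (Q u c x + Q u c (x + h)) = 0 := by
    intro h h0 h1
    simp_rw [Q_add, sgn_add]
    rw [← Finset.mul_sum, inner_zero, mul_zero]
    intro hb
    have : h ^ 2 ^ (2 * u) = h := (CharTwo.add_eq_zero.mp hb).symm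
    rcases fix_of m u hK hg h this with h' | h' <;> contradiction
  have h3 : ∀ h : K, h + h ^ 2 ^ (2 * u) = 0 →
      ∑ x : K, sgn (Q u c x + Q u c (x + h)) = 2 ^ m * sgn (Q u c h) := by
    intro h hh
    simp_rw [Q_add, hh]
    simp [tr, hK]
  rw [h1, ← Finset.sum_subset (Finset.subset_univ {0, 1}) (by
    intro x _ hx
    simp only [Finset.mem_insert, Finset.mem_singleton, not_or] at hx
    exact h2 x hx.1 hx.2)]
  rw [Finset.sum_pair zero_ne_one, h3 0 (by simp), h3 1 (by simp [CharTwo.add_self_eq_zero])]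
  simp [Q, tr, sgn_zero]
  ring

lemma S_eq_count (u m : ℕ) (c : K) (hK : Fintype.card K = 2 ^ m) :
    S K u c = 2 * (Nat.card {x : K // Q u c x = 0} : ℤ) - 2 ^ m := by
  classical
  have : ∀ x : K, sgn (Q u c x) = 2 * (if Q u c x = 0 then 1 else 0) - 1 := by
    intro x; unfold sgn; split_ifs <;> norm_num
  unfold S
  simp_rw [this]
  rw [Finset.sum_sub_distrib, ← Finset.mul_sum]
  simp [hK, Fintype.card_subtype]

lemma mem_range_of_pow {L : Type} [Field L] [Fintype L] (g : L →+* K) (y : K)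
    (hy : y ^ Fintype.card L = y) : ∃ x, g x = y := by
  classical
  have hq := Fintype.one_lt_card (α := L)
  have hne : (Polynomial.X ^ Fintype.card L - Polynomial.X : Polynomial K) ≠ 0 :=
    FiniteField.X_pow_card_sub_X_ne_zero K hq
  have hsub : Finset.univ.image g ⊆
      (Polynomial.X ^ Fintype.card L - Polynomial.X : Polynomial K).roots.toFinset := by
    intro z hz
    obtain ⟨x, _, rfl⟩ := Finset.mem_image.mp hz
    rw [Multiset.mem_toFinset, Polynomial.mem_roots hne]
    simp [← map_pow, FiniteField.pow_card]
  have hcard : (Polynomial.X ^ Fintype.card L - Polynomial.X : Polynomial K).roots.toFinset.card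
      ≤ (Finset.univ.image g).card := by
    rw [Finset.card_image_of_injective _ g.injective, Finset.card_univ]
    refine (Multiset.toFinset_card_le _).trans ((Polynomial.card_roots' _).trans ?_)
    rw [FiniteField.X_pow_card_sub_X_natDegree_eq K hq]
  have heq := Finset.eq_of_subset_of_card_le hsub hcard
  have : y ∈ Finset.univ.image g := by
    rw [heq, Multiset.mem_toFinset, Polynomial.mem_roots hne]
    simp [hy]
  obtain ⟨x, _, hx⟩ := Finset.mem_image.mp this
  exact ⟨x, hx⟩

lemma tr_emb {L : Type} [Field L] [Fintype L] [Algebra (ZMod 2) L] (g : L →ₐ[ZMod 2] K)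
    (n l : ℕ) (hl : Odd l) (hn : 0 < n)
    (hL : Fintype.card L = 2 ^ n) (hK : Fintype.card K = 2 ^ (l * n)) (x : L) :
    tr (g x) = tr x := by
  let _ := g.toRingHom.toAlgebra
  have : IsScalarTower (ZMod 2) L K := IsScalarTower.of_algebraMap_eq fun r => (g.commutes r).symm
  have hr : Module.finrank L K = l := by
    have := Module.card_eq_pow_finrank (K := L) (V := K)
    rw [hL, hK, ← pow_mul] at this
    have := Nat.pow_right_injective le_rfl this
    rw [mul_comm] at this
    exact (Nat.eq_of_mul_eq_mul_left hn this).symm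
  have h1 := Algebra.trace_trace (R := ZMod 2) (S := L) (algebraMap L K x)
  rw [Algebra.trace_algebraMap, hr] at h1
  change tr (algebraMap L K x) = tr x
  unfold tr
  rw [← h1, map_nsmul]
  obtain ⟨k, rfl⟩ := hl
  rw [add_smul, mul_comm, mul_smul, two_smul, z2]
  simp

lemma Q_frob (u n : ℕ) (x : K) : Q u 1 (x ^ 2 ^ n) = Q u 1 x := by
  unfold Q
  rw [← tr_pow (x ^ (2 ^ u + 1) + 1 * x) n, add_pow_two_pow, one_mul, one_mul,
    ← pow_mul, ← pow_mul, mul_comm (2 ^ n)]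

lemma count_modEq {L : Type} [Field L] [Fintype L] [Algebra (ZMod 2) L] (g : L →ₐ[ZMod 2] K)
    (n l u : ℕ) (hl : Odd l) (hp : l.Prime) (hn : 0 < n)
    (hL : Fintype.card L = 2 ^ n) (hK : Fintype.card K = 2 ^ (l * n)) :
    Nat.card {x : K // Q u 1 x = 0} ≡ Nat.card {x : L // Q u 1 x = 0} [MOD l] := by
  classical
  have hfact := Fact.mk hp
  let f : Function.End {x : K // Q u 1 x = 0} := fun x => ⟨x.1 ^ 2 ^ n, (Q_frob u n x.1).trans x.2⟩
  have it : ∀ k, ∀ x, ((f ^ k) x).1 = x.1 ^ 2 ^ (k * n) := by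
    intro k
    induction k with
    | zero =>
      intro x
      rw [zero_mul, pow_zero, pow_zero, pow_one]
      rfl
    | succ k ih =>
      intro x
      rw [pow_succ']
      change ((f ^ k) x).1 ^ 2 ^ n = _
      rw [ih, ← pow_mul, ← pow_add, add_mul, one_mul]
  have hf : f ^ l ^ 1 = 1 := by
    funext x
    apply Subtype.ext
    rw [it, pow_one, ← hK, FiniteField.pow_card]
    rfl
  have key := Equiv.Perm.card_fixedPoints_modEq hf
  have hQ : ∀ x : L, Q u 1 (g x) = Q u 1 x := by
    intro x
    unfold Q
    rw [← tr_emb g n l hl hn hL hK]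
    simp
  rw [Nat.card_eq_fintype_card, Nat.card_eq_fintype_card]
  refine key.trans (Nat.ModEq.symm ?_)
  have : Fintype.card {x : L // Q u 1 x = 0} = Fintype.card (Function.fixedPoints f) := by
    refine Fintype.card_congr (Equiv.ofBijective (fun x => ⟨⟨g x.1, by rw [hQ, x.2]⟩, ?_⟩) ⟨?_, ?_⟩)
    · apply Subtype.ext
      change g x.1 ^ 2 ^ n = g x.1
      rw [← map_pow, ← hL, FiniteField.pow_card]
    · intro x y hxy
      apply Subtype.ext
      apply g.toRingHom.injective
      exact congrArg (fun z => z.1.1) hxy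
    · rintro ⟨⟨y, hy⟩, hfy⟩
      have h1 : y ^ 2 ^ n = y := congrArg Subtype.val hfy
      obtain ⟨x, hx⟩ := mem_range_of_pow g.toRingHom y (by rw [hL, h1])
      change g x = y at hx
      refine ⟨⟨x, ?_⟩, ?_⟩
      · rw [← hQ, hx, hy]
      · apply Subtype.ext
        apply Subtype.ext
        exact hx
  rw [this]

lemma tr_one (m : ℕ) (hm : Odd m) (hK : Fintype.card K = 2 ^ m) : tr (1 : K) = 1 := by
  have h1 := Algebra.trace_algebraMap (R := ZMod 2) (S := K) 1
  have hr : Module.finrank (ZMod 2) K = m := by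
    have := Module.card_eq_pow_finrank (K := ZMod 2) (V := K)
    rw [ZMod.card, hK] at this
    exact (Nat.pow_right_injective le_rfl this).symm
  rw [map_one, hr] at h1
  unfold tr
  rw [h1, nsmul_one]
  exact (ZMod.natCast_eq_one_iff_odd).mpr hm

noncomputable instance (m : ℕ) : Fintype (GaloisField 2 m) := Fintype.ofFinite _

lemma cardGF (m : ℕ) (hm : m ≠ 0) : Fintype.card (GaloisField 2 m) = 2 ^ m := by
  rw [← Nat.card_eq_fintype_card, GaloisField.card 2 m hm]

lemma gcd2 (m u : ℕ) (hm : Odd m) (hg : Nat.gcd u m = 1) : Nat.gcd (2 * u) m = 1 :=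
  Nat.Coprime.mul_left (Nat.coprime_two_left.mpr hm) hg

lemma S_val (m u : ℕ) (hm : Odd m) (hg : Nat.gcd u m = 1) :
    S (GaloisField 2 m) u 1 = ZMod.χ₈ (m : ZMod 8) * 2 ^ ((m + 1) / 2) := by
  induction m using Nat.strong_induction_on with
  | _ m ih =>
  have hm0 : m ≠ 0 := by rintro rfl; simp at hm
  have hK := cardGF m hm0
  by_cases h1 : m = 1
  · subst h1
    have hx : ∀ x : GaloisField 2 1, Q u 1 x = 0 := by
      intro x
      have h2 : ∀ k, x ^ 2 ^ k = x := by
        intro k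
        induction k with
        | zero => simp
        | succ k ih =>
          rw [pow_succ, pow_mul, ih]
          have := FiniteField.pow_card x
          rwa [hK, pow_one] at this
      unfold Q
      rw [pow_succ, h2, one_mul, ← sq, tr, map_add]
      have := tr_sq x
      unfold tr at this
      rw [this, z2]
    unfold S
    simp_rw [hx]
    simp [sgn_zero, hK]
  · obtain ⟨l, hp, n, rfl⟩ : ∃ l, l.Prime ∧ ∃ n, m = l * n :=
      ⟨m.minFac, Nat.minFac_prime h1, Nat.minFac_dvd m⟩
    have hfact := Fact.mk hp
    obtain ⟨hl, hn⟩ := Nat.odd_mul.mp hm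
    have hn0 : 0 < n := hn.pos
    have hL := cardGF n hn0.ne'
    have hlt : n < l * n := by nlinarith [hp.two_le]
    have ihn := ih n hlt hn (Nat.Coprime.coprime_dvd_right (Dvd.intro_left l rfl) hg)
    obtain ⟨g⟩ : Nonempty (GaloisField 2 n →ₐ[ZMod 2] GaloisField 2 (l * n)) := by
      apply FiniteField.nonempty_algHom_of_finrank_dvd
      rw [GaloisField.finrank 2 hn0.ne', GaloisField.finrank 2 hm0]
      exact Dvd.intro_left l rfl
    have hc := count_modEq g n l u hl hp hn0 hL hK
    have hc' := (ZMod.natCast_eq_natCast_iff _ _ _).mpr hc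
    have e1 := S_eq_count u (l * n) (1 : GaloisField 2 (l * n)) hK
    have e2 := S_eq_count u n (1 : GaloisField 2 n) hL
    have hmod : ((S (GaloisField 2 (l * n)) u 1 : ℤ) : ZMod l) =
        ((S (GaloisField 2 n) u 1 : ℤ) : ZMod l) := by
      rw [e1, e2]
      push_cast
      rw [hc', mul_comm l n, pow_mul, ZMod.pow_card]
    have hl2 : l ≠ 2 := by rintro rfl; exact absurd hl (by decide)
    have hleg : ((ZMod.χ₈ (l : ZMod 8) : ℤ) : ZMod l) = 2 ^ (l / 2) := by
      rw [← legendreSym.at_two hl2, legendreSym.eq_pow]; simp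
    have hsq : S (GaloisField 2 (l * n)) u 1 ^ 2 = (2 ^ ((l * n + 1) / 2)) ^ 2 := by
      rw [S_sq (l * n) u hK (gcd2 _ _ hm hg), one_add_one_eq_two,
        show (2 : GaloisField 2 (l * n)) = 0 from CharTwo.two_eq_zero]
      simp only [tr, map_zero, sgn_zero]
      rw [← pow_mul, Nat.div_mul_cancel (by obtain ⟨k, hk⟩ := hm; omega)]
      ring
    have hchi : ∀ k : ℕ, Odd k → ZMod.χ₈ (k : ZMod 8) = 1 ∨ ZMod.χ₈ (k : ZMod 8) = -1 := by
      intro k hk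
      rw [ZMod.χ₈_nat_eq_if_mod_eight]
      have := Nat.odd_iff.mp hk
      rw [if_neg (by omega)]
      split_ifs <;> simp
    -- the target congruence
    have hexp : (l * n + 1) / 2 = n * (l / 2) + (n + 1) / 2 := by
      obtain ⟨a, rfl⟩ := hl
      obtain ⟨b, rfl⟩ := hn
      have h1 : ((2 * a + 1) * (2 * b + 1) + 1) / 2 = 2 * a * b + a + b + 1 := by
        rw [show (2 * a + 1) * (2 * b + 1) + 1 = 2 * (2 * a * b + a + b + 1) by ring]
        simp
      rw [h1, show (2 * a + 1) / 2 = a by omega, show (2 * b + 1 + 1) / 2 = b + 1 by omega]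
      ring
    have htgt : ((S (GaloisField 2 (l * n)) u 1 : ℤ) : ZMod l) =
        ((ZMod.χ₈ ((l * n : ℕ) : ZMod 8) * 2 ^ ((l * n + 1) / 2) : ℤ) : ZMod l) := by
      rw [hmod, ihn, hexp]
      push_cast
      rw [map_mul, pow_add, mul_comm n, pow_mul]
      push_cast
      rw [← hleg]
      have hpw : (ZMod.χ₈ (l : ZMod 8)) * (ZMod.χ₈ (l : ZMod 8)) ^ n = 1 := by
        rcases hchi l hl with h | h <;> rw [h]
        · simp
        · rw [hn.neg_one_pow]; norm_num
      have hpw' := congrArg (Int.cast : ℤ → ZMod l) hpw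
      push_cast at hpw'
      linear_combination (-(ZMod.χ₈ (n : ZMod 8) : ZMod l) * 2 ^ ((n + 1) / 2)) * hpw'
    have h2ne : (2 : ZMod l) ≠ 0 := by
      intro h
      have : ((2 : ℕ) : ZMod l) = 0 := by exact_mod_cast h
      rw [ZMod.natCast_eq_zero_iff] at this
      exact hl2 ((Nat.prime_dvd_prime_iff_eq hp Nat.prime_two).mp this)
    have hcontra : ∀ k : ℕ, (2 : ZMod l) ^ k ≠ -2 ^ k := by
      intro k h
      have : (2 : ZMod l) ^ (k + 1) = 0 := by linear_combination h
      exact pow_ne_zero _ h2ne this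
    rcases sq_eq_sq_iff_eq_or_eq_neg.mp hsq with h | h <;>
    rcases hchi (l * n) hm with h' | h' <;> rw [h, h'] at htgt ⊢
    · simp
    · push_cast at htgt
      exact absurd (by simpa using htgt) (hcontra _)
    · push_cast at htgt
      exact absurd (by simpa using htgt.symm) (hcontra _)
    · simp

lemma S_zero (m u : ℕ) (hm : Odd m) (hg : Nat.gcd u m = 1) :
    S (GaloisField 2 m) u 0 = 0 := by
  have hK := cardGF m hm.pos.ne'
  have h := S_sq m u hK (gcd2 _ _ hm hg) (0 : GaloisField 2 m)
  rw [add_zero, tr_one m hm hK, sgn_one] at h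
  simpa using h

lemma eps (m : ℕ) (hm : Odd m) :
    ZMod.χ₈ (m : ZMod 8) = (-1) ^ ((m ^ 2 - 1) / 8) := by
  rw [ZMod.χ₈_nat_eq_if_mod_eight]
  have h2 := Nat.odd_iff.mp hm
  rw [if_neg (by omega)]
  obtain ⟨k, r, hr, rfl⟩ : ∃ k r, r < 8 ∧ m = 8 * k + r :=
    ⟨m / 8, m % 8, Nat.mod_lt _ (by norm_num), (Nat.div_add_mod m 8).symm⟩
  have hr8 : (8 * k + r) % 8 = r := by omega
  rw [hr8]
  have hr' : r % 2 = 1 := by omega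
  interval_cases r <;> simp at hr' <;> simp
  · rw [show ((8 * k + 1) ^ 2 - 1) / 8 = 2 * (4 * k * k + k) by
      rw [show (8 * k + 1) ^ 2 = 8 * (2 * (4 * k * k + k)) + 1 by ring]; omega]
    simp
  · rw [show ((8 * k + 3) ^ 2 - 1) / 8 = 2 * (4 * k * k + 3 * k) + 1 by
      rw [show (8 * k + 3) ^ 2 = 8 * (2 * (4 * k * k + 3 * k) + 1) + 1 by ring]; omega]
    simp [pow_succ]
  · rw [show ((8 * k + 5) ^ 2 - 1) / 8 = 2 * (4 * k * k + 5 * k + 1) + 1 by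
      rw [show (8 * k + 5) ^ 2 = 8 * (2 * (4 * k * k + 5 * k + 1) + 1) + 1 by ring]; omega]
    simp [pow_succ]
  · rw [show ((8 * k + 7) ^ 2 - 1) / 8 = 2 * (4 * k * k + 7 * k + 3) by
      rw [show (8 * k + 7) ^ 2 = 8 * (2 * (4 * k * k + 7 * k + 3)) + 1 by ring]; omega]
    simp

lemma card_formula (m u : ℕ) (hm : Odd m) (ρ : ZMod 2) :
    4 * (Nat.card (Dset m u ρ) : ℤ) =
      2 ^ m + sgn ρ * (S (GaloisField 2 m) u 0 - S (GaloisField 2 m) u 1) := by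
  classical
  have hK := cardGF m hm.pos.ne'
  have hlin : ∑ x : GaloisField 2 m, sgn (tr x) = 0 := by
    refine sum_sgn_linear (Algebra.trace (ZMod 2) (GaloisField 2 m)).toAddMonoidHom ⟨1, ?_⟩
    have := tr_one (K := GaloisField 2 m) m hm hK
    change tr (1 : GaloisField 2 m) ≠ 0
    rw [this]; decide
  have hpt : ∀ a b r : ZMod 2, (4 * (if a = 1 ∧ b = r then 1 else 0) : ℤ) =
      1 - sgn a + sgn r * (sgn b - sgn (b + a)) := by decide
  have hcard : (Nat.card (Dset m u ρ) : ℤ) =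
      ∑ x : GaloisField 2 m, if tr x = 1 ∧ tr (x ^ (2 ^ u + 1)) = ρ then 1 else 0 := by
    rw [Finset.sum_boole, ← Fintype.card_subtype, ← Nat.card_eq_fintype_card]
    rfl
  rw [hcard, Finset.mul_sum]
  simp_rw [hpt]
  rw [Finset.sum_add_distrib, Finset.sum_sub_distrib, hlin, ← Finset.mul_sum,
    Finset.sum_sub_distrib]
  simp [S, Q, tr, hK]

end GoldSum

theorem card_Dset (m u : ℕ) (hm : 5 ≤ m) (hmodd : Odd m) (hu : 0 < u)
    (hgcd : Nat.gcd u m = 1) :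
    (Nat.card (Dset m u 0) : ℤ) =
      2 ^ (m - 2) - (-1) ^ ((m ^ 2 - 1) / 8) * 2 ^ ((m - 3) / 2) ∧
    (Nat.card (Dset m u 1) : ℤ) =
      2 ^ (m - 2) + (-1) ^ ((m ^ 2 - 1) / 8) * 2 ^ ((m - 3) / 2) := by
  have h0 := GoldSum.card_formula m u hmodd 0
  have h1 := GoldSum.card_formula m u hmodd 1
  rw [GoldSum.S_zero m u hmodd hgcd, GoldSum.S_val m u hmodd hgcd, GoldSum.eps m hmodd] at h0 h1
  rw [GoldSum.sgn_zero] at h0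
  rw [GoldSum.sgn_one] at h1
  have e1 : (2 : ℤ) ^ m = 4 * 2 ^ (m - 2) := by
    rw [show m = (m - 2) + 2 by omega, pow_add]; simp; ring
  have e2 : (2 : ℤ) ^ ((m + 1) / 2) = 4 * 2 ^ ((m - 3) / 2) := by
    rw [show (m + 1) / 2 = (m - 3) / 2 + 2 by omega, pow_add]; ring
  rw [e1, e2] at h0 h1
  constructor
  · linarith
  · linarith
end
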